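/- arXiv:1003.1096 — 10 statements merged into one kernel-verified Lean document; each statement's English description precedes it below -/
import Mathlib

section
/- Let X be a connected simple graph, let e be an edge of X, and let k be a positive integer. Then there are only finitely many k-separators of X which contain the edge e. -/
/-- The set of edges of `G` with one endpoint in `C` and one endpoint in `D`. -/
def edgesBetween {V : Type*} (G : SimpleGraph V) (C D : Set V) : Set (Sym2 V) :=
  {e | e ∈ G.edgeSet ∧ ∃ x ∈ C, ∃ y ∈ D, e = s(x, y)}

/-- The edge boundary `δC` of a set of vertices `C`. -/
def edgeBoundary {V : Type*} (G : SimpleGraph V) (C : Set V) : Set (Sym2 V) :=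
  edgesBetween G C Cᶜ

/-- A set of vertices is connected if the induced subgraph is connected. -/
def ConnSet {V : Type*} (G : SimpleGraph V) (C : Set V) : Prop :=
  (G.induce C).Connected

/-- A `k`-separator is an edge boundary `δC` of cardinality `k` where both `C` and `Cᶜ`
are connected. -/
def IsSeparator {V : Type*} (G : SimpleGraph V) (k : ℕ) (F : Set (Sym2 V)) : Prop :=
  ∃ C : Set V, F = edgeBoundary G C ∧ ConnSet G C ∧ ConnSet G Cᶜ ∧ F.Finite ∧ F.ncard = k

theorem edgeBoundary_compl {V : Type*} (G : SimpleGraph V) (C : Set V) :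
    edgeBoundary G Cᶜ = edgeBoundary G C := by
  ext f
  constructor
  · rintro ⟨hf, u, hu, v, hv, rfl⟩
    exact ⟨hf, v, by simpa using hv, u, hu, Sym2.eq_swap⟩
  · rintro ⟨hf, u, hu, v, hv, rfl⟩
    exact ⟨hf, v, hv, u, by simpa using hu, Sym2.eq_swap⟩

theorem edgeBoundary_deleteEdges {V : Type*} (G : SimpleGraph V) (s : Set (Sym2 V)) (C : Set V) :
    edgeBoundary (G.deleteEdges s) C = edgeBoundary G C \ s := by
  ext f
  simp only [edgeBoundary, edgesBetween, SimpleGraph.edgeSet_deleteEdges, Set.mem_ofPred_eq,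
    Set.mem_sdiff]
  tauto

/-- Deleting an edge that leaves `C` does not affect the connectedness of `C`. -/
theorem ConnSet.deleteEdges {V : Type*} {G : SimpleGraph V} {C : Set V} (hC : ConnSet G C)
    {x y : V} (hy : y ∉ C) : ConnSet (G.deleteEdges {s(x, y)}) C := by
  refine SimpleGraph.Connected.mono ?_ hC
  rintro ⟨a, ha⟩ ⟨b, hb⟩ hab
  simp only [SimpleGraph.comap_adj, Function.Embedding.subtype_apply,
    SimpleGraph.deleteEdges_adj, Set.mem_singleton_iff] at hab ⊢
  refine ⟨hab, fun h => ?_⟩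
  rcases Sym2.eq_iff.mp h with ⟨-, rfl⟩ | ⟨rfl, -⟩
  · exact hy hb
  · exact hy ha

theorem ConnSet.reachable {V : Type*} {G : SimpleGraph V} {C : Set V} (hC : ConnSet G C)
    {u v : V} (hu : u ∈ C) (hv : v ∈ C) : G.Reachable u v :=
  (hC.preconnected ⟨u, hu⟩ ⟨v, hv⟩).map (SimpleGraph.Embedding.induce C).toHom

/-- The side of a separator may be chosen to contain the first end of a given edge. -/
theorem IsSeparator.exists_side {V : Type*} {G : SimpleGraph V} {k : ℕ} {F : Set (Sym2 V)}
    (hF : IsSeparator G k F) {x y : V} (he : s(x, y) ∈ F) :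
    ∃ C : Set V, F = edgeBoundary G C ∧ ConnSet G C ∧ ConnSet G Cᶜ ∧ x ∈ C ∧ y ∉ C := by
  obtain ⟨C, rfl, hC, hC', -, -⟩ := hF
  obtain ⟨-, a, ha, b, hb, hab⟩ := id he
  rcases Sym2.eq_iff.mp hab with ⟨rfl, rfl⟩ | ⟨rfl, rfl⟩
  · exact ⟨C, rfl, hC, hC', ha, hb⟩
  · exact ⟨Cᶜ, (edgeBoundary_compl G C).symm, hC', by rwa [compl_compl], hb, by simpa using ha⟩

/-- A separator containing a bridge consists of that bridge only. -/
theorem IsSeparator.eq_singleton {V : Type*} {G : SimpleGraph V} {k : ℕ} {F : Set (Sym2 V)}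
    (hF : IsSeparator G k F) {x y : V} (he : s(x, y) ∈ F)
    (hxy : ¬ (G.deleteEdges {s(x, y)}).Reachable x y) : F = {s(x, y)} := by
  refine Set.Subset.antisymm (fun f hf => ?_) (Set.singleton_subset_iff.mpr he)
  obtain ⟨C, rfl, hC, hC', hx, hy⟩ := hF.exists_side he
  obtain ⟨hfG, u, hu, v, hv, rfl⟩ := hf
  by_contra hne
  have huv : (G.deleteEdges {s(x, y)}).Adj u v :=
    SimpleGraph.deleteEdges_adj.mpr ⟨hfG, hne⟩
  have hC'' : ConnSet (G.deleteEdges {s(x, y)}) Cᶜ := by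
    rw [Sym2.eq_swap]
    exact hC'.deleteEdges (by simpa using hx)
  exact hxy ((((hC.deleteEdges hy).reachable hx hu).trans huv.reachable).trans
    (hC''.reachable hv hy))

/-- Removing an edge from a separator gives a separator of the graph without that edge. -/
theorem IsSeparator.deleteEdges {V : Type*} {G : SimpleGraph V} {k : ℕ} {F : Set (Sym2 V)}
    (hF : IsSeparator G (k + 1) F) {x y : V} (he : s(x, y) ∈ F) :
    IsSeparator (G.deleteEdges {s(x, y)}) k (F \ {s(x, y)}) := by
  obtain ⟨C, hFC, hC, hC', hx, hy⟩ := hF.exists_side he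
  obtain ⟨-, -, -, -, hfin, hcard⟩ := hF
  refine ⟨C, by rw [edgeBoundary_deleteEdges, hFC], hC.deleteEdges hy, ?_, hfin.sdiff, ?_⟩
  · rw [Sym2.eq_swap]
    exact hC'.deleteEdges (by simpa using hx)
  · rw [Set.ncard_sdiff_singleton_of_mem he, hcard, Nat.add_sub_cancel]

/-- A separator contains an edge of every walk joining the ends of one of its edges in a
spanning subgraph. -/
theorem IsSeparator.exists_mem_edges {V : Type*} {G H : SimpleGraph V} {k : ℕ}
    {F : Set (Sym2 V)} (hF : IsSeparator G k F) {x y : V} (he : s(x, y) ∈ F) (hH : H ≤ G)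
    (p : H.Walk x y) : ∃ f ∈ p.edges, f ∈ F := by
  obtain ⟨C, rfl, -, -, hx, hy⟩ := hF.exists_side he
  obtain ⟨d, hd, hd₁, hd₂⟩ := p.exists_boundary_dart C hx hy
  exact ⟨d.edge, List.mem_map_of_mem hd, hH d.adj, d.fst, hd₁, d.snd, hd₂, rfl⟩

theorem finite_setOf_isSeparator {V : Type*} (k : ℕ) (G : SimpleGraph V) (e : Sym2 V) :
    {F : Set (Sym2 V) | IsSeparator G k F ∧ e ∈ F}.Finite := by
  induction k generalizing G e with
  | zero =>
    refine Set.finite_empty.subset ?_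
    rintro F ⟨⟨-, -, -, -, hfin, hcard⟩, he⟩
    rw [(Set.ncard_eq_zero hfin).mp hcard] at he
    exact he
  | succ k ih =>
    induction e with
    | _ x y =>
    by_cases hxy : (G.deleteEdges {s(x, y)}).Reachable x y
    · obtain ⟨p⟩ := hxy
      refine (p.edges.finite_toSet.biUnion fun f _ =>
        (ih (G.deleteEdges {s(x, y)}) f).image (insert s(x, y))).subset ?_
      rintro F ⟨hF, he⟩
      obtain ⟨f, hf, hfF⟩ := hF.exists_mem_edges he (G.deleteEdges_le _) p
      have hne : f ∉ ({s(x, y)} : Set (Sym2 V)) := by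
        have := p.edges_subset_edgeSet hf
        rw [SimpleGraph.edgeSet_deleteEdges] at this
        exact this.2
      exact Set.mem_biUnion (show f ∈ {f | f ∈ p.edges} from hf)
        ⟨F \ {s(x, y)}, ⟨hF.deleteEdges he, hfF, hne⟩, Set.insert_sdiff_self_of_mem he⟩
    · refine (Set.finite_singleton {s(x, y)}).subset ?_
      rintro F ⟨hF, he⟩
      exact hF.eq_singleton he hxy

/-- There are only finitely many `k`-separators containing a given edge. -/
theorem finitely_many_separators {V : Type*} (G : SimpleGraph V) (hG : G.Connected)
    (e : Sym2 V) (he : e ∈ G.edgeSet) (k : ℕ) (hk : 0 < k) :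
    {F : Set (Sym2 V) | IsSeparator G k F ∧ e ∈ F}.Finite :=
  finite_setOf_isSeparator k G e
end

section
/- Let C and D be minimal cuts of a graph X. If C ∩ D and Cᶜ ∩ Dᶜ are both cuts, then C ∩ D and Cᶜ ∩ Dᶜ are minimal cuts. -/
/-- A set of vertices contains a ray: a one-way infinite path all of whose
vertices lie in the set. -/
def HasRay {V : Type*} (G : SimpleGraph V) (C : Set V) : Prop :=
  ∃ r : ℕ → V, Function.Injective r ∧ (∀ n, G.Adj (r n) (r (n + 1))) ∧ ∀ n, r n ∈ C

/-- A cut: `δC` is finite, `C` and `Cᶜ` are connected and both contain a ray. -/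
def IsCut {V : Type*} (G : SimpleGraph V) (C : Set V) : Prop :=
  (edgeBoundary G C).Finite ∧ ConnSet G C ∧ ConnSet G Cᶜ ∧ HasRay G C ∧ HasRay G Cᶜ

/-- A minimal cut: a cut whose edge boundary has the minimal cardinality `κ`
among all cuts. -/
def IsMinCut {V : Type*} (G : SimpleGraph V) (C : Set V) : Prop :=
  IsCut G C ∧ ∀ D : Set V, IsCut G D → (edgeBoundary G C).ncard ≤ (edgeBoundary G D).ncard

/-- Two sets of vertices are nested. -/
def Nested {V : Type*} (C D : Set V) : Prop :=
  C ⊆ D ∨ D ⊆ C ∨ C ∩ D = ∅ ∨ C ∪ D = Set.univ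

/-- `M(C)`: the set of minimal cuts which are not nested with `C`. -/
def Mset {V : Type*} (G : SimpleGraph V) (C : Set V) : Set (Set V) :=
  {D : Set V | IsMinCut G D ∧ ¬ Nested D C}

theorem mk_mem_edgeBoundary {V : Type*} {G : SimpleGraph V} {C : Set V} {x y : V} :
    s(x, y) ∈ edgeBoundary G C ↔ G.Adj x y ∧ (x ∈ C ∧ y ∉ C ∨ y ∈ C ∧ x ∉ C) := by
  simp only [edgeBoundary, edgesBetween, Set.mem_ofPred_eq, SimpleGraph.mem_edgeSet,
    Set.mem_compl_iff, Sym2.eq_iff]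
  grind

/-- The size of the edge boundary is submodular on opposite corners. -/
theorem ncard_edgeBoundary_corners_le {V : Type*} (G : SimpleGraph V) {C D : Set V}
    (hC : (edgeBoundary G C).Finite) (hD : (edgeBoundary G D).Finite) :
    (edgeBoundary G (C ∩ D)).ncard + (edgeBoundary G (Cᶜ ∩ Dᶜ)).ncard ≤
      (edgeBoundary G C).ncard + (edgeBoundary G D).ncard := by
  have hunion : edgeBoundary G (C ∩ D) ∪ edgeBoundary G (Cᶜ ∩ Dᶜ) ⊆
      edgeBoundary G C ∪ edgeBoundary G D := by
    intro e
    induction e with | _ x y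
    simp only [Set.mem_union, mk_mem_edgeBoundary, Set.mem_inter_iff, Set.mem_compl_iff]
    tauto
  have hinter : edgeBoundary G (C ∩ D) ∩ edgeBoundary G (Cᶜ ∩ Dᶜ) ⊆
      edgeBoundary G C ∩ edgeBoundary G D := by
    intro e
    induction e with | _ x y
    simp only [mk_mem_edgeBoundary, Set.mem_inter_iff, Set.mem_compl_iff]
    tauto
  have hfin := (hC.union hD).subset hunion
  rw [← Set.ncard_union_add_ncard_inter _ _ (hfin.subset Set.subset_union_left)
      (hfin.subset Set.subset_union_right),
    ← Set.ncard_union_add_ncard_inter _ _ hC hD]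
  exact add_le_add (Set.ncard_le_ncard hunion (hC.union hD))
    (Set.ncard_le_ncard hinter (hC.inter_of_left _))

/-- If `C` and `D` are minimal cuts and `C ∩ D` and `Cᶜ ∩ Dᶜ` are cuts, then
`C ∩ D` and `Cᶜ ∩ Dᶜ` are minimal cuts. -/
theorem corner_cuts_minimal {V : Type*} (G : SimpleGraph V) (C D : Set V)
    (hC : IsMinCut G C) (hD : IsMinCut G D)
    (h1 : IsCut G (C ∩ D)) (h2 : IsCut G (Cᶜ ∩ Dᶜ)) :
    IsMinCut G (C ∩ D) ∧ IsMinCut G (Cᶜ ∩ Dᶜ) := by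
  have hsub := ncard_edgeBoundary_corners_le G hC.1.1 hD.1.1
  have hC1 := hC.2 _ h1
  have hC2 := hC.2 _ h2
  have hD1 := hD.2 _ h1
  have hD2 := hD.2 _ h2
  refine ⟨⟨h1, fun E hE => ?_⟩, ⟨h2, fun E hE => ?_⟩⟩
  · have := hC.2 E hE
    omega
  · have := hC.2 E hE
    omega
end

section
/- Let C and D be minimal cuts of a graph X such that C ∩ D and Cᶜ ∩ Dᶜ are both cuts. Then δ(C ∩ Dᶜ, Cᶜ ∩ D) = ∅, i.e. there is no edge with one endpoint in C ∩ Dᶜ and the other endpoint in Cᶜ ∩ D. -/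
theorem mem_edgeBoundary {V : Type*} {G : SimpleGraph V} {S : Set V} {x y : V} :
    s(x, y) ∈ edgeBoundary G S ↔ G.Adj x y ∧ ¬ (x ∈ S ↔ y ∈ S) := by
  simp only [edgeBoundary, edgesBetween, Set.mem_ofPred_eq, SimpleGraph.mem_edgeSet, Sym2.eq_iff,
    Set.mem_compl_iff]
  refine and_congr_right fun _ => ⟨?_, fun h => ?_⟩
  · rintro ⟨a, ha, b, hb, ⟨rfl, rfl⟩ | ⟨rfl, rfl⟩⟩ <;> tauto
  · by_cases hx : x ∈ S
    · exact ⟨x, hx, y, by tauto, by simp⟩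
    · exact ⟨y, by tauto, x, hx, by simp⟩

/-- If `C` and `D` are minimal cuts and `C ∩ D` and `Cᶜ ∩ Dᶜ` are cuts, then there is
no edge with one endpoint in `C ∩ Dᶜ` and the other endpoint in `Cᶜ ∩ D`. -/
theorem no_diagonal_edges {V : Type*} (G : SimpleGraph V) (C D : Set V)
    (hC : IsMinCut G C) (hD : IsMinCut G D)
    (h1 : IsCut G (C ∩ D)) (h2 : IsCut G (Cᶜ ∩ Dᶜ)) :
    edgesBetween G (C ∩ Dᶜ) (Cᶜ ∩ D) = ∅ := by
  refine Set.eq_empty_iff_forall_notMem.mpr ?_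
  rintro e ⟨he, x, ⟨hxC, hxD⟩, y, ⟨hyC, hyD⟩, rfl⟩
  rw [Set.mem_compl_iff] at hxD hyC
  have hunion : edgeBoundary G (C ∩ D) ∪ edgeBoundary G (Cᶜ ∩ Dᶜ) ⊆
      (edgeBoundary G C ∪ edgeBoundary G D) \ {s(x, y)} := by
    intro f
    induction f using Sym2.ind with | _ a b
    simp only [Set.mem_union, Set.mem_sdiff, Set.mem_singleton_iff, mem_edgeBoundary,
      Set.mem_inter_iff, Set.mem_compl_iff, Sym2.eq_iff]
    intro h
    refine ⟨by tauto, ?_⟩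
    rintro (⟨rfl, rfl⟩ | ⟨rfl, rfl⟩) <;> tauto
  have hinter : edgeBoundary G (C ∩ D) ∩ edgeBoundary G (Cᶜ ∩ Dᶜ) ⊆
      edgeBoundary G C ∩ edgeBoundary G D := by
    intro f
    induction f using Sym2.ind with | _ a b
    simp only [Set.mem_inter_iff, mem_edgeBoundary, Set.mem_compl_iff]
    tauto
  have hmem : s(x, y) ∈ edgeBoundary G C ∪ edgeBoundary G D :=
    Or.inl (mem_edgeBoundary.mpr ⟨he, by tauto⟩)
  have hfin := hC.1.1.union hD.1.1
  have hcard := Set.ncard_le_ncard hunion hfin.sdiff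
  have hcard' := Set.ncard_le_ncard hinter (hC.1.1.inter_of_left _)
  have hlt := Set.ncard_sdiff_singleton_lt_of_mem hmem hfin
  have hsum := Set.ncard_union_add_ncard_inter _ _ h1.1 h2.1
  have hsum' := Set.ncard_union_add_ncard_inter _ _ hC.1.1 hD.1.1
  have hle := hC.2 _ h1
  have hle' := hD.2 _ h2
  omega
end

section
/- Let C, D, E be subsets of a set V, and suppose C and D are not nested. If E is not nested with two opposite corners of C and D, then E is not nested with C and E is not nested with D. -/
theorem not_nested_iff {V : Type*} {C D : Set V} :
    ¬ Nested C D ↔ (C ∩ Dᶜ).Nonempty ∧ (Cᶜ ∩ D).Nonempty ∧ (C ∩ D).Nonempty ∧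
      (Cᶜ ∩ Dᶜ).Nonempty := by
  simp only [Nested, not_or, Set.not_subset, Set.Nonempty, Set.eq_empty_iff_forall_notMem,
    Set.eq_univ_iff_forall, Set.mem_inter_iff, Set.mem_union, Set.mem_compl_iff, not_forall,
    not_not]
  simp only [and_comm]

/-- If `E` crosses a subset of `C` and a subset of `Cᶜ`, then it crosses `C`. -/
theorem not_nested_of_subset_of_subset_compl {V : Type*} {C E X Y : Set V}
    (hX : ¬ Nested E X) (hY : ¬ Nested E Y) (hXC : X ⊆ C) (hYC : Y ⊆ Cᶜ) :
    ¬ Nested E C := by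
  rw [not_nested_iff] at *
  obtain ⟨-, hX', hX, -⟩ := hX
  obtain ⟨-, hY', hY, -⟩ := hY
  exact ⟨hY.mono (Set.inter_subset_inter_right _ hYC),
    hX'.mono (Set.inter_subset_inter_right _ hXC),
    hX.mono (Set.inter_subset_inter_right _ hXC),
    hY'.mono (Set.inter_subset_inter_right _ hYC)⟩

/-- If `C` and `D` are not nested and `E` is not nested with two opposite corners of
`C` and `D`, then `E` is not nested with `C` and `E` is not nested with `D`. -/
theorem not_nested_of_not_nested_opposite_corners {V : Type*} (C D E : Set V)
    (hCD : ¬ Nested C D)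
    (h : (¬ Nested E (C ∩ D) ∧ ¬ Nested E (Cᶜ ∩ Dᶜ)) ∨
         (¬ Nested E (C ∩ Dᶜ) ∧ ¬ Nested E (Cᶜ ∩ D))) :
    ¬ Nested E C ∧ ¬ Nested E D := by
  rcases h with ⟨h₁, h₂⟩ | ⟨h₁, h₂⟩
  · exact ⟨not_nested_of_subset_of_subset_compl h₁ h₂ Set.inter_subset_left Set.inter_subset_left,
      not_nested_of_subset_of_subset_compl h₁ h₂ Set.inter_subset_right Set.inter_subset_right⟩
  · exact ⟨not_nested_of_subset_of_subset_compl h₁ h₂ Set.inter_subset_left Set.inter_subset_left,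
      not_nested_of_subset_of_subset_compl h₂ h₁ Set.inter_subset_right Set.inter_subset_right⟩
end

section
/- Let C, D, E be subsets of a set V, and suppose C and D are not nested. If E is not nested with some corner of C and D, then E is not nested with C or E is not nested with D. -/
theorem Nested.symm {V : Type*} {C D : Set V} (h : Nested C D) : Nested D C := by
  rcases h with h | h | h | h
  · exact .inr (.inl h)
  · exact .inl h
  · exact .inr (.inr (.inl (Set.inter_comm D C ▸ h)))
  · exact .inr (.inr (.inr (Set.union_comm D C ▸ h)))

theorem Nested.compl_right {V : Type*} {C D : Set V} (h : Nested C D) : Nested C Dᶜ := by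
  simp only [Nested, Set.subset_def, Set.ext_iff, Set.mem_inter_iff, Set.mem_union,
    Set.mem_compl_iff, Set.mem_empty_iff_false, Set.mem_univ] at *
  rcases h with h | h | h | h
  · exact .inr (.inr (.inl (by grind)))
  · exact .inr (.inr (.inr (by grind)))
  · exact .inl (by grind)
  · exact .inr (.inl (by grind))

theorem nested_compl_right_iff {V : Type*} {C D : Set V} : Nested C Dᶜ ↔ Nested C D :=
  ⟨fun h => compl_compl D ▸ h.compl_right, Nested.compl_right⟩

theorem nested_compl_left_iff {V : Type*} {C D : Set V} : Nested Cᶜ D ↔ Nested C D :=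
  ⟨fun h => (nested_compl_right_iff.1 h.symm).symm, fun h => h.symm.compl_right.symm⟩

/-- A set nested with two crossing sets is nested with their intersection. -/
theorem Nested.inter_right {V : Type*} {C D E : Set V} (hCD : ¬ Nested C D)
    (hC : Nested E C) (hD : Nested E D) : Nested E (C ∩ D) := by
  simp only [Nested, Set.subset_def, Set.ext_iff, Set.mem_inter_iff, Set.mem_union,
    Set.mem_empty_iff_false, Set.mem_univ] at *
  rcases hC with hC | hC | hC | hC <;> rcases hD with hD | hD | hD | hD <;> grind

/-- If `C` and `D` are not nested and `E` is not nested with some corner of `C` and `D`,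
then `E` is not nested with `C` or `E` is not nested with `D`. -/
theorem not_nested_of_not_nested_corner {V : Type*} (C D E : Set V)
    (hCD : ¬ Nested C D)
    (h : ¬ Nested E (C ∩ D) ∨ ¬ Nested E (C ∩ Dᶜ) ∨
         ¬ Nested E (Cᶜ ∩ D) ∨ ¬ Nested E (Cᶜ ∩ Dᶜ)) :
    ¬ Nested E C ∨ ¬ Nested E D := by
  by_contra! hE
  obtain ⟨hC, hD⟩ := hE
  rcases h with h | h | h | h <;> refine h (Nested.inter_right ?_ ?_ ?_) <;>
    simpa only [nested_compl_left_iff, nested_compl_right_iff]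
end

section
/- Let C and D be cuts of a graph X which are not nested. Then there is a pair of opposite corners of C and D each of which contains a ray; that is, either both C ∩ D and Cᶜ ∩ Dᶜ contain a ray, or both C ∩ Dᶜ and Cᶜ ∩ D contain a ray. -/
/-- The edges of an injective sequence of vertices are pairwise distinct. -/
theorem injective_consecutive_edges {V : Type*} {r : ℕ → V} (hr : Function.Injective r) :
    Function.Injective fun n => s(r n, r (n + 1)) := by
  intro m n h
  rcases Sym2.eq_iff.mp h with ⟨h₁, -⟩ | ⟨h₁, h₂⟩
  · exact hr h₁
  · have := hr h₁
    have := hr h₂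
    omega

/-- A ray that crosses a finite edge boundary is eventually on one side of it. -/
theorem HasRay.inter_or_inter_compl {V : Type*} {G : SimpleGraph V} {S T : Set V}
    (hS : HasRay G S) (hT : (edgeBoundary G T).Finite) :
    HasRay G (S ∩ T) ∨ HasRay G (S ∩ Tᶜ) := by
  obtain ⟨r, hinj, hadj, hmem⟩ := hS
  obtain ⟨N, hN⟩ := (hT.preimage (injective_consecutive_edges hinj).injOn).bddAbove
  have hstep : ∀ n, N < n → (r n ∈ T ↔ r (n + 1) ∈ T) := by
    intro n hn
    have hnot : s(r n, r (n + 1)) ∉ edgeBoundary G T := fun h => absurd (hN h) (by omega)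
    constructor
    · intro h
      by_contra h'
      exact hnot ⟨hadj n, _, h, _, h', rfl⟩
    · intro h
      by_contra h'
      exact hnot ⟨hadj n, _, h, _, h', Sym2.eq_swap⟩
  have hside : ∀ k, r (N + 1 + k) ∈ T ↔ r (N + 1) ∈ T := by
    intro k
    induction k with
    | zero => rfl
    | succ k ih => exact (hstep (N + 1 + k) (by omega)).symm.trans ih
  have htail : Function.Injective fun k => r (N + 1 + k) :=
    hinj.comp (add_right_injective (N + 1))
  by_cases h : r (N + 1) ∈ T
  · exact .inl ⟨_, htail, fun k => hadj (N + 1 + k), fun k => ⟨hmem _, (hside k).mpr h⟩⟩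
  · exact .inr ⟨_, htail, fun k => hadj (N + 1 + k), fun k => ⟨hmem _, mt (hside k).mp h⟩⟩

/-- If cuts `C` and `D` are not nested, then some pair of opposite corners of `C` and `D`
both contain a ray. -/
theorem opposite_corners_hasRay {V : Type*} (G : SimpleGraph V) (C D : Set V)
    (hC : IsCut G C) (hD : IsCut G D) (hCD : ¬ Nested C D) :
    (HasRay G (C ∩ D) ∧ HasRay G (Cᶜ ∩ Dᶜ)) ∨
    (HasRay G (C ∩ Dᶜ) ∧ HasRay G (Cᶜ ∩ D)) := by
  obtain ⟨hCfin, -, -, hCray, hCcray⟩ := hC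
  obtain ⟨hDfin, -, -, hDray, hDcray⟩ := hD
  have h₁ := hCray.inter_or_inter_compl hDfin
  have h₂ := hCcray.inter_or_inter_compl hDfin
  have h₃ := hDray.inter_or_inter_compl hCfin
  have h₄ := hDcray.inter_or_inter_compl hCfin
  rw [Set.inter_comm D, Set.inter_comm D] at h₃
  rw [Set.inter_comm Dᶜ, Set.inter_comm Dᶜ] at h₄
  tauto
end

section
/- Let a group G act by automorphisms and without edge inversion on an infinite tree T, such that the action is transitive on the edges of T and has exactly two orbits on the vertices of T. Let {P, Q} be an edge of T and let G_e = G_P ∩ G_Q. Then the canonical homomorphism from the amalgamated free product G_P *_{G_e} G_Q (the pushout of the two inclusions G_e → G_P and G_e → G_Q) to G, induced by the inclusions of G_P and G_Q into G, is an isomorphism. -/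
open MulAction

/-- A ping-pong criterion for injectivity of a homomorphism out of an amalgamated product: the sets
`S i` contain the images of the reduced words whose first letter lies in the `i`-th factor. -/
theorem Monoid.PushoutI.lift_injective_of_pingPong {ι H K : Type*} {M : ι → Type*}
    [∀ i, Group (M i)] [Group H] [Group K] {φ : ∀ i, H →* M i}
    (f : ∀ i, M i →* K) (k : H →* K) (hf : ∀ i, (f i).comp (φ i) = k)
    (hφ : ∀ i, Function.Injective (φ i)) (hk : Function.Injective k) (S : ι → Set K)
    (hletter : ∀ i g, g ∉ (φ i).range → f i g ∈ S i)
    (hcons : ∀ i j g x, i ≠ j → g ∉ (φ i).range → x ∈ S j → f i g * x ∈ S i)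
    (hbase : ∀ i h x, x ∈ S i → k h * x ∈ S i)
    (hone : ∀ i, 1 ∉ S i) :
    Function.Injective (Monoid.PushoutI.lift (φ := φ) f k hf) := by
  classical
  obtain ⟨d⟩ := NormalWord.transversal_nonempty φ hφ
  have key (w : NormalWord d) :
      (w.fstIdx = none ∧ w.prod = base φ w.head) ∨
        ∃ i, w.fstIdx = some i ∧ lift f k hf w.prod ∈ S i := by
    induction w using NormalWord.consRecOn with
    | empty => exact Or.inl ⟨by simp [CoprodI.Word.fstIdx], by simp⟩
    | cons i g w hmw hgn hgr hw ih =>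
      refine Or.inr ⟨i, by simp [CoprodI.Word.fstIdx], ?_⟩
      rw [NormalWord.prod_cons, map_mul, lift_of]
      rcases ih with ⟨-, h⟩ | ⟨j, hj, h⟩
      · rw [h, hw, map_one, map_one, mul_one]
        exact hletter i g hgr
      · exact hcons i j g _ (by rintro rfl; exact hmw hj) hgr h
    | base h w hw ih =>
      rw [NormalWord.base_smul_eq_smul]
      rcases ih with ⟨h₁, h₂⟩ | ⟨i, h₁, h₂⟩
      · refine Or.inl ⟨h₁, ?_⟩
        rw [NormalWord.prod_base_smul, h₂, hw, NormalWord.base_smul_def', hw]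
        simp
      · refine Or.inr ⟨i, h₁, ?_⟩
        rw [NormalWord.prod_base_smul, map_mul, lift_base]
        exact hbase i h _ h₂
  rw [injective_iff_map_eq_one]
  intro x hx
  obtain ⟨w, rfl⟩ := (NormalWord.equiv (d := d)).symm.surjective x
  change w.prod = 1
  replace hx : lift f k hf w.prod = 1 := hx
  rcases key w with ⟨-, h⟩ | ⟨i, -, h⟩
  · rw [h, lift_base, map_eq_one_iff k hk] at hx
    rw [h, hx, map_one]
  · rw [hx] at h
    exact absurd h (hone i)

namespace SimpleGraph

/-- In a tree, a vertex has at most one neighbor that is closer to a given vertex. -/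
theorem IsTree.eq_of_adj_of_dist_lt {V : Type*} {T : SimpleGraph V} (hT : T.IsTree) {u v a b : V}
    (ha : T.Adj a v) (hb : T.Adj b v) (hua : T.dist u a < T.dist u v)
    (hub : T.dist u b < T.dist u v) : a = b := by
  have aux {c : V} (hc : T.Adj c v) (huc : T.dist u c < T.dist u v) :
      ∃ p : T.Walk u v, p.IsPath ∧ p.penultimate = c := by
    obtain ⟨p, hp⟩ := hT.connected.exists_walk_length_eq_dist u c
    refine ⟨p.concat hc, (p.concat hc).isPath_of_length_eq_dist ?_, by simp⟩
    have := dist_le (p.concat hc)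
    rw [Walk.length_concat] at this ⊢
    omega
  obtain ⟨p, hp, rfl⟩ := aux ha hua
  obtain ⟨q, hq, rfl⟩ := aux hb hub
  rw [(hT.existsUnique_path u v).unique hp hq]

variable {V G : Type*} [Group G] [MulAction G V] {T : SimpleGraph V}

theorem dist_smul_smul_of_adj_smul
    (hadj : ∀ (g : G) (x y : V), T.Adj x y → T.Adj (g • x) (g • y)) (hT : T.Connected)
    (g : G) (x y : V) : T.dist (g • x) (g • y) = T.dist x y := by
  have aux (g : G) (x y : V) : T.dist (g • x) (g • y) ≤ T.dist x y := by
    obtain ⟨p, hp⟩ := hT.exists_walk_length_eq_dist x y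
    rw [← hp, ← p.length_map ⟨(g • ·), hadj g _ _⟩]
    exact dist_le _
  exact (aux g x y).antisymm (by simpa using aux g⁻¹ (g • x) (g • y))

/-- An automorphism of a tree that fixes the endpoint `x` of the edge `{x, y}` but not `y` moves
the half-tree at `y` into the half-tree at `x`. -/
theorem IsTree.dist_smul_lt_of_smul_eq (hT : T.IsTree)
    (hadj : ∀ (g : G) (x y : V), T.Adj x y → T.Adj (g • x) (g • y)) {x y v : V} {g : G}
    (hxy : T.Adj x y) (hx : g • x = x) (hy : g • y ≠ y) (hv : T.dist v y < T.dist v x) :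
    T.dist (g • v) x < T.dist (g • v) y := by
  by_contra! h
  have h₁ : T.dist (g • v) x = T.dist v x := by
    simpa [hx] using dist_smul_smul_of_adj_smul hadj hT.connected g v x
  have h₂ := dist_smul_smul_of_adj_smul hadj hT.connected g v y
  have hgy : T.Adj (g • y) x := by simpa [hx] using hadj g y x hxy.symm
  exact hy (hT.eq_of_adj_of_dist_lt hgy hxy.symm (by omega)
    (h.lt_of_ne (hT.dist_ne_of_adj _ hxy.symm)))

/-- If `{x, y}` is an edge of a connected graph and a subgroup `H` acts so that every neighbor of
`x` is in the `H`-orbit of `y` and conversely, then the orbits of `x` and `y` cover the graph. -/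
theorem Connected.exists_smul_eq_of_forall_adj (hT : T.Connected)
    (hadj : ∀ (g : G) (x y : V), T.Adj x y → T.Adj (g • x) (g • y)) {x y : V} (H : Subgroup G)
    (hx : ∀ v, T.Adj x v → ∃ h ∈ H, h • y = v) (hy : ∀ v, T.Adj y v → ∃ h ∈ H, h • x = v) (v : V) :
    ∃ h ∈ H, h • x = v ∨ h • y = v := by
  have aux {a b v : V} (hab : ∀ w, T.Adj a w → ∃ h ∈ H, h • b = w) {h : G} (hH : h ∈ H)
      (hv : T.Adj (h • a) v) : ∃ h' ∈ H, h' • b = v := by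
    obtain ⟨g, hg, hgv⟩ := hab (h⁻¹ • v) (by simpa using hadj h⁻¹ _ _ hv)
    exact ⟨h * g, mul_mem hH hg, by rw [mul_smul, hgv, smul_inv_smul]⟩
  induction (reachable_iff_reflTransGen x v).1 (hT x v) with
  | refl => exact ⟨1, one_mem H, Or.inl (one_smul G x)⟩
  | tail _ hbc ih =>
    obtain ⟨h, hH, rfl | rfl⟩ := ih
    · obtain ⟨g, hg, hgv⟩ := aux hx hH hbc
      exact ⟨g, hg, Or.inr hgv⟩
    · obtain ⟨g, hg, hgv⟩ := aux hy hH hbc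
      exact ⟨g, hg, Or.inl hgv⟩

end SimpleGraph

/-- Bass-Serre: if `G` acts without inversion on an infinite tree, transitively on
edges and with two vertex orbits represented by the endpoints `P, Q` of an edge, then
the canonical homomorphism from the amalgamated free product
`G_P *_{G_e} G_Q` (the pushout of the inclusions of `G_e = G_P ⊓ G_Q`) to `G` is an
isomorphism. -/
theorem amalgam_of_action_on_tree {V G : Type*} (T : SimpleGraph V) [Infinite V]
    (hT : T.IsTree) [Group G] [MulAction G V]
    (hadj : ∀ (g : G) (x y : V), T.Adj x y → T.Adj (g • x) (g • y))
    (hinv : ¬ ∃ (g : G) (x y : V), T.Adj x y ∧ g • x = y ∧ g • y = x)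
    (hedge : ∀ x y x' y' : V, T.Adj x y → T.Adj x' y' →
      ∃ g : G, (g • x = x' ∧ g • y = y') ∨ (g • x = y' ∧ g • y = x'))
    (P Q : V) (hPQ : T.Adj P Q)
    (horb : ∀ v : V, (∃ g : G, g • P = v) ∨ (∃ g : G, g • Q = v))
    (hne : ¬ ∃ g : G, g • P = Q)
    (φ : ∀ b : Bool, ↥(stabilizer G P ⊓ stabilizer G Q) →*
        ↥(cond b (stabilizer G P) (stabilizer G Q)))
    (hφ : ∀ b x, ((φ b x : G)) = (x : G)) :
    Function.Bijective (Monoid.PushoutI.lift (φ := φ)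
      (fun b : Bool => (cond b (stabilizer G P) (stabilizer G Q)).subtype)
      ((stabilizer G P ⊓ stabilizer G Q).subtype)
      (by intro b; ext x; simp [hφ])) := by
  refine ⟨?_, ?_⟩
  · let A : Bool → Set V := fun b =>
      cond b {v | T.dist v P < T.dist v Q} {v | T.dist v Q < T.dist v P}
    have hPP : T.dist P P < T.dist P Q := by
      simpa using hT.connected.pos_dist_of_ne hPQ.ne
    have hQQ : T.dist Q Q < T.dist Q P := by
      simpa using hT.connected.pos_dist_of_ne hPQ.symm.ne
    have hmem (g : G) (hg : g ∈ stabilizer G P ⊓ stabilizer G Q) : g • P = P ∧ g • Q = Q := hg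
    have hmove (b : Bool) (g : ↥(cond b (stabilizer G P) (stabilizer G Q)))
        (hg : g ∉ (φ b).range) (v : V) (hv : v ∈ A (!b)) : (g : G) • v ∈ A b := by
      have hg' : (g : G) ∉ stabilizer G P ⊓ stabilizer G Q := fun h =>
        hg ⟨⟨g, h⟩, Subtype.ext (hφ b _)⟩
      obtain ⟨g, hgb⟩ := g
      cases b with
      | true =>
        exact hT.dist_smul_lt_of_smul_eq hadj hPQ hgb (fun h => hg' ⟨hgb, h⟩) hv
      | false =>
        exact hT.dist_smul_lt_of_smul_eq hadj hPQ.symm hgb (fun h => hg' ⟨h, hgb⟩) hv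
    refine Monoid.PushoutI.lift_injective_of_pingPong _ _ _ (fun b x y hxy => ?_)
      Subtype.val_injective (fun b => {g | g • P ∈ A b ∧ g • Q ∈ A b}) ?_ ?_ ?_ ?_
    · exact Subtype.ext (by rw [← hφ b, ← hφ b, hxy])
    · intro b g hg
      have hg₁ := hmove b g hg
      obtain ⟨g, hgb⟩ := g
      cases b with
      | true =>
        refine ⟨?_, hg₁ Q hQQ⟩
        change g • P ∈ _
        rw [show g • P = P from hgb]
        exact hPP
      | false =>
        refine ⟨hg₁ P hPP, ?_⟩
        change g • Q ∈ _
        rw [show g • Q = Q from hgb]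
        exact hQQ
    · intro b c g x hbc hg hx
      obtain rfl : c = !b := by cases b <;> cases c <;> simp_all
      simp only [Set.mem_ofPred_eq, mul_smul]
      exact ⟨hmove b g hg _ hx.1, hmove b g hg _ hx.2⟩
    · rintro b ⟨h, hh⟩ x ⟨hxP, hxQ⟩
      have hA (v : V) (hv : v ∈ A b) : h • v ∈ A b := by
        have h₁ := SimpleGraph.dist_smul_smul_of_adj_smul hadj hT.connected h v P
        have h₂ := SimpleGraph.dist_smul_smul_of_adj_smul hadj hT.connected h v Q
        rw [(hmem h hh).1] at h₁
        rw [(hmem h hh).2] at h₂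
        cases b with
        | true =>
          change T.dist (h • v) P < T.dist (h • v) Q
          rwa [h₁, h₂]
        | false =>
          change T.dist (h • v) Q < T.dist (h • v) P
          rwa [h₁, h₂]
      simp only [Set.mem_ofPred_eq, mul_smul]
      exact ⟨hA _ hxP, hA _ hxQ⟩
    · rintro b ⟨hP, hQ⟩
      rw [one_smul] at hP hQ
      cases b with
      | true => exact lt_asymm hQQ hQ
      | false => exact lt_asymm hPP hP
  · rw [← MonoidHom.range_eq_top, Subgroup.eq_top_iff']
    intro g
    set F := Monoid.PushoutI.lift (φ := φ)
      (fun b : Bool => (cond b (stabilizer G P) (stabilizer G Q)).subtype)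
      ((stabilizer G P ⊓ stabilizer G Q).subtype) (by intro b; ext x; simp [hφ])
    have hP (g : G) (hg : g • P = P) : g ∈ F.range :=
      ⟨Monoid.PushoutI.of true ⟨g, hg⟩, by simp [F]⟩
    have hQ (g : G) (hg : g • Q = Q) : g ∈ F.range :=
      ⟨Monoid.PushoutI.of false ⟨g, hg⟩, by simp [F]⟩
    obtain ⟨h, hh, h' | h'⟩ := hT.connected.exists_smul_eq_of_forall_adj hadj (x := P) (y := Q)
      F.range
      (fun v hv => by
        obtain ⟨k, ⟨h₁, h₂⟩ | ⟨-, h₂⟩⟩ := hedge P Q P v hPQ hv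
        · exact ⟨k, hP k h₁, h₂⟩
        · exact absurd ⟨k⁻¹, by rw [← h₂, inv_smul_smul]⟩ hne)
      (fun v hv => by
        obtain ⟨k, ⟨h₁, -⟩ | ⟨h₁, h₂⟩⟩ := hedge P Q Q v hPQ hv
        · exact absurd ⟨k, h₁⟩ hne
        · exact ⟨k, hQ k h₂, h₁⟩)
      (g • P)
    · have := mul_mem hh (hP (h⁻¹ * g) (by rw [mul_smul, ← h', inv_smul_smul]))
      rwa [mul_inv_cancel_left] at this
    · exact absurd ⟨h⁻¹ * g, by rw [mul_smul, ← h', inv_smul_smul]⟩ hne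
end

section
/- Let a group G act by automorphisms and vertex-transitively on an infinite tree T. Then there is an edge {P, Q} of T such that G splits over the pointwise stabilizer G_P ∩ G_Q of this edge. -/
/-- A group `G` splits over a subgroup `A` if either `G` is (canonically isomorphic to)
a non-trivial amalgamated free product `H *_A J` of two subgroups `H, J` containing `A`
(the pushout of the inclusions `A → H` and `A → J`), or `G` is (canonically isomorphic
to) an HNN extension of a subgroup `H` containing `A` over the conjugation isomorphism
`a ↦ t a t⁻¹` from `A` to `tAt⁻¹`, the stable letter being sent to `t`. -/
def SplitsOver (G : Type*) [Group G] (A : Subgroup G) : Prop :=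
  (∃ (H J : Subgroup G) (hH : A ≤ H) (hJ : A ≤ J), A ≠ H ∧ A ≠ J ∧
    Function.Bijective (Monoid.PushoutI.lift
      (φ := fun b : Bool => Subgroup.inclusion (show A ≤ cond b H J by cases b <;> assumption))
      (fun b : Bool => (cond b H J).subtype) A.subtype
      (by intro b; ext x; simp))) ∨
  (∃ (H : Subgroup G) (hA : A ≤ H) (t : G)
      (hconj : A.map (MulAut.conj t).toMonoidHom ≤ H)
      (φ : A.subgroupOf H ≃* (A.map (MulAut.conj t).toMonoidHom).subgroupOf H),
    (∀ a, ((φ a : ↥H) : G) = t * ((a : ↥H) : G) * t⁻¹) ∧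
    ∃ hx : ∀ a : ↥(A.subgroupOf H), t * H.subtype ↑a = H.subtype ↑(φ a) * t,
      Function.Bijective (HNNExtension.lift (φ := φ) H.subtype t hx))

open MulAction

namespace SimpleGraph

/-- A locally injective homomorphism from a preconnected graph to an acyclic graph is injective. -/
theorem Hom.injective_of_locally_injective {X V : Type*} {S : SimpleGraph X} {T : SimpleGraph V}
    (hS : S.Preconnected) (hT : T.IsAcyclic) (f : S →g T)
    (hf : ∀ x y z, S.Adj x y → S.Adj x z → f y = f z → y = z) : Function.Injective f := by
  have chain : ∀ {x y : X} (p : S.Walk x y), p.IsPath → (p.map f).edges.IsChain (· ≠ ·) := by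
    intro x y p hp
    induction p with
    | nil => simp
    | cons h p ih =>
      cases p with
      | nil => simp
      | cons h' p =>
        have hp' := ih hp.of_cons
        simp only [Walk.map_cons, Walk.edges_cons, List.isChain_cons_cons] at hp' ⊢
        refine ⟨fun he => ?_, hp'⟩
        rw [Sym2.eq_iff] at he
        have hne : f _ ≠ f _ := (f.map_adj h).ne
        rcases he with he | he
        · exact hne he.1
        · have := hf _ _ _ h.symm h' he.1
          subst this
          simp [Walk.cons_isPath_iff] at hp
  intro x y hxy
  obtain ⟨p, hp⟩ := (hS x y).exists_isPath
  have hq := (hT.isPath_iff_isChain (p.map f)).2 (chain p hp)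
  have hnil : ∀ {v w : V} (q : T.Walk v w), q.IsPath → v = w → q.length = 0 := by
    rintro v _ q hq rfl
    exact Walk.length_eq_zero_iff.2 (Walk.isPath_iff_nil.1 hq)
  have h0 := hnil _ hq hxy
  rw [Walk.length_map] at h0
  exact Walk.eq_of_length_eq_zero h0

end SimpleGraph

namespace TreeAction

variable {V G : Type*} [Group G] [MulAction G V]

/-- The elements `g` for which the pair `{P, g • P}` is a translate of `{P, s • P}`. -/
def doubleCosets (P : V) (s : G) : Set G :=
  {g | ∃ l ∈ stabilizer G P, ∃ m ∈ stabilizer G P, g = l * s * m ∨ g = l * s⁻¹ * m}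

theorem inv_mem_doubleCosets {P : V} {s g : G} (h : g ∈ doubleCosets P s) :
    g⁻¹ ∈ doubleCosets P s := by
  obtain ⟨l, hl, m, hm, h⟩ := h
  refine ⟨m⁻¹, inv_mem hm, l⁻¹, inv_mem hl, ?_⟩
  rcases h with rfl | rfl
  · right; group
  · left; group

theorem mem_doubleCosets_of_smul_eq {P : V} {s g h l : G} (hl : l ∈ stabilizer G P)
    (hg : g ∈ doubleCosets P s) (hgh : h • P = l • g • P) : h ∈ doubleCosets P s := by
  obtain ⟨a, ha, b, hb, hab⟩ := hg
  refine ⟨l * a, mul_mem hl ha, b * (g⁻¹ * l⁻¹ * h), mul_mem hb ?_, ?_⟩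
  · simp [mem_stabilizer_iff, mul_smul, hgh]
  · rcases hab with rfl | rfl
    · left; group
    · right; group

theorem self_mem_doubleCosets (P : V) (s : G) : s ∈ doubleCosets P s :=
  ⟨1, one_mem _, 1, one_mem _, by simp⟩

theorem inv_self_mem_doubleCosets (P : V) (s : G) : s⁻¹ ∈ doubleCosets P s :=
  inv_mem_doubleCosets (self_mem_doubleCosets P s)

/-- The elements carrying `P` to a neighbour along an edge that is not a translate of
`{P, s • P}`. -/
def steps (T : SimpleGraph V) (P : V) (s : G) : Set G :=
  {g | T.Adj P (g • P) ∧ g ∉ doubleCosets P s}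

/-- The subgroup generated by the stabilizer of `P` and by `steps T P s`. If `T` is a tree and the
action is vertex-transitive, this is the stabilizer of the component of `P` in the forest obtained
from `T` by deleting all translates of the edge `{P, s • P}`. -/
def componentStabilizer (T : SimpleGraph V) (P : V) (s : G) : Subgroup G :=
  stabilizer G P ⊔ Subgroup.closure (steps T P s)

variable {T : SimpleGraph V} {P : V} {s : G}

theorem stabilizer_le_componentStabilizer : stabilizer G P ≤ componentStabilizer T P s :=
  le_sup_left

theorem mem_componentStabilizer_of_mem_steps {g : G} (h : g ∈ steps T P s) :
    g ∈ componentStabilizer T P s :=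
  le_sup_right (a := stabilizer G P) (Subgroup.subset_closure h)

theorem inv_mem_steps (hadj : ∀ (g : G) (x y : V), T.Adj x y → T.Adj (g • x) (g • y)) {g : G}
    (h : g ∈ steps T P s) : g⁻¹ ∈ steps T P s := by
  refine ⟨?_, fun hd => h.2 (inv_inv g ▸ inv_mem_doubleCosets hd)⟩
  simpa using (hadj g⁻¹ _ _ h.1).symm

/-- The stabilizer of the component of `P` and `s` generate the whole group. -/
theorem eq_top_of_componentStabilizer_le (hT : T.Connected)
    (hadj : ∀ (g : G) (x y : V), T.Adj x y → T.Adj (g • x) (g • y))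
    (hvert : ∀ v w : V, ∃ g : G, g • v = w) {M : Subgroup G}
    (hM : componentStabilizer T P s ≤ M) (hs : s ∈ M) : M = ⊤ := by
  have hP : stabilizer G P ≤ M := stabilizer_le_componentStabilizer.trans hM
  have key : ∀ v, ∃ m ∈ M, m • P = v := by
    intro v
    induction (SimpleGraph.reachable_iff_reflTransGen P v).1 (hT.preconnected P v) with
    | refl => exact ⟨1, one_mem _, one_smul G P⟩
    | @tail _ u _ h ih =>
      obtain ⟨m, hm, rfl⟩ := ih
      obtain ⟨g, hg⟩ := hvert P (m⁻¹ • u)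
      refine ⟨m * g, mul_mem hm ?_, by rw [mul_smul, hg, smul_inv_smul]⟩
      by_cases hD : g ∈ doubleCosets P s
      · obtain ⟨a, ha, b, hb, rfl | rfl⟩ := hD
        · exact mul_mem (mul_mem (hP ha) hs) (hP hb)
        · exact mul_mem (mul_mem (hP ha) (inv_mem hs)) (hP hb)
      · refine hM (mem_componentStabilizer_of_mem_steps ⟨?_, hD⟩)
        rw [hg]
        simpa using hadj m⁻¹ _ _ h
  refine eq_top_iff.2 fun g _ => ?_
  obtain ⟨m, hm, hmg⟩ := key (g • P)
  have : m⁻¹ * g ∈ M := hP (by simp [mem_stabilizer_iff, mul_smul, ← hmg])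
  simpa using mul_mem hm this

/-- A group `Γ` over `G` generated by a lift of the component stabilizer and a lift `τ` of `s`,
in which the relations visible on the edge `{P, s • P}` hold, is isomorphic to `G`. -/
theorem bijective_of_relations {Γ : Type*} [Group Γ] (hT : T.IsTree)
    (hadj : ∀ (g : G) (x y : V), T.Adj x y → T.Adj (g • x) (g • y))
    (hvert : ∀ v w : V, ∃ g : G, g • v = w) (hPs : T.Adj P (s • P))
    (π : Γ →* G) (i : componentStabilizer T P s →* Γ) (τ : Γ)
    (hπi : ∀ h, π (i h) = h) (hπτ : π τ = s)
    (hgen : i.range ⊔ Subgroup.zpowers τ = ⊤)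
    (hrel : ∀ a b : componentStabilizer T P s, (a : G) • P = P → (a : G) • s • P = s • P →
      (b : G) = s⁻¹ * a * s → i a * τ = τ * i b)
    (hinv : (∀ k : G, k • P = s • P → k • s • P ≠ P) ∨
      ∃ a : componentStabilizer T P s, (a : G) • P = P ∧ τ * τ = i a) :
    Function.Bijective π := by
  let L : Subgroup Γ := ((stabilizer G P).subgroupOf (componentStabilizer T P s)).map i
  have hL : ∀ h : componentStabilizer T P s, (h : G) • P = P → i h ∈ L := fun h hh =>
    Subgroup.mem_map_of_mem i (Subgroup.mem_subgroupOf.2 hh)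
  have hL' : ∀ {l : Γ}, l ∈ L → ∃ h : componentStabilizer T P s, (h : G) • P = P ∧ i h = l := by
    rintro _ ⟨h, hh, rfl⟩
    exact ⟨h, hh, rfl⟩
  have hPH : ∀ {g : G}, g • P = P → g ∈ componentStabilizer T P s := fun h => stabilizer_le_componentStabilizer h
  let S : Set Γ := {γ | (∃ h : componentStabilizer T P s, (h : G) ∈ steps T P s ∧ γ = i h) ∨ γ = τ ∨ γ = τ⁻¹}
  have hSinv : ∀ γ ∈ S, γ⁻¹ ∈ S := by
    rintro γ (⟨h, hh, rfl⟩ | rfl | rfl)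
    · exact Or.inl ⟨h⁻¹, inv_mem_steps hadj hh, by simp⟩
    · exact Or.inr (Or.inr rfl)
    · exact Or.inr (Or.inl (by simp))
  have hSadj : ∀ γ ∈ S, T.Adj P (π γ • P) := by
    rintro γ (⟨h, hh, rfl⟩ | rfl | rfl)
    · rw [hπi]; exact hh.1
    · rwa [hπτ]
    · rw [map_inv, hπτ]; simpa using (hadj s⁻¹ _ _ hPs).symm
  have hpos : ∀ l : componentStabilizer T P s, (l : G) • P = P → s • P = (l : G) • s • P → τ⁻¹ * i l * τ ∈ L := by
    intro l hl h
    have hb : (s⁻¹ * l * s) • P = P := by simp [mul_smul, ← h]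
    rw [mul_assoc, hrel l ⟨_, hPH hb⟩ hl h.symm rfl, inv_mul_cancel_left]
    exact hL _ hb
  have hneg : ∀ l : componentStabilizer T P s, (l : G) • P = P → s⁻¹ • P = (l : G) • s⁻¹ • P →
      τ * i l * τ⁻¹ ∈ L := by
    intro l hl h
    have hb : (s * l * s⁻¹) • P = P := by simp [mul_smul, ← h]
    rw [← hrel ⟨_, hPH hb⟩ l hb (by simp [mul_smul, hl]) (by simp [mul_assoc]),
      mul_inv_cancel_right]
    exact hL _ hb
  have hmix : ∀ l : componentStabilizer T P s, (l : G) • P = P → s • P = (l : G) • s⁻¹ • P → τ⁻¹ * i l * τ⁻¹ ∈ L := by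
    intro l hl h
    rcases hinv with hinv | ⟨a, ha, hτ⟩
    · refine absurd ?_ (hinv (s * (l : G)⁻¹) ?_)
      · simp [mul_smul, h]
      · rw [mul_smul, inv_smul_eq_iff.2 hl.symm]
    · have hτ' : τ⁻¹ = τ * (i a)⁻¹ := by rw [← hτ]; group
      have hs : s⁻¹ = s * (a : G)⁻¹ := by
        rw [← hπi, ← hτ, map_mul, hπτ]; group
      have ha' : (a : G)⁻¹ • P = P := inv_smul_eq_iff.2 ha.symm
      have h1 := hpos l hl (by rwa [hs, mul_smul, ha'] at h)
      nth_rw 2 [hτ']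
      rw [← mul_assoc]
      exact mul_mem h1 (inv_mem (hL a ha))
  have key : ∀ γ ∈ S, ∀ δ ∈ S, ∀ l : componentStabilizer T P s, (l : G) • P = P →
      π γ • P = (l : G) • π δ • P → γ⁻¹ * i l * δ ∈ L := by
    rintro γ hγ δ hδ l hl h
    have hl' : (l : G)⁻¹ • P = P := inv_smul_eq_iff.2 hl.symm
    have hcon : ∀ {g k : G}, g ∉ doubleCosets P s → k ∈ doubleCosets P s →
        g • P = (l : G) • k • P → False := fun hg hk h =>
      hg (mem_doubleCosets_of_smul_eq hl hk h)
    have hcon' : ∀ {g k : G}, g ∈ doubleCosets P s → k ∉ doubleCosets P s →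
        g • P = (l : G) • k • P → False := fun hg hk h =>
      hk (mem_doubleCosets_of_smul_eq (l := (l : G)⁻¹) hl' hg (by rw [h, inv_smul_smul]))
    rcases hγ with ⟨g, hg, rfl⟩ | rfl | rfl <;> rcases hδ with ⟨k, hk, rfl⟩ | rfl | rfl <;>
      simp only [map_inv, hπi, hπτ] at h
    · rw [← map_inv, ← map_mul, ← map_mul]
      apply hL
      simp [mul_smul, ← h]
    · exact (hcon hg.2 (self_mem_doubleCosets P s) h).elim
    · exact (hcon hg.2 (inv_self_mem_doubleCosets P s) h).elim
    · exact (hcon' (self_mem_doubleCosets P s) hk.2 h).elim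
    · exact hpos l hl h
    · exact hmix l hl h
    · exact (hcon' (inv_self_mem_doubleCosets P s) hk.2 h).elim
    · have h1 := hmix l⁻¹ hl'
        (by rw [Subgroup.coe_inv, h, inv_smul_smul])
      simpa [mul_assoc] using inv_mem h1
    · simpa using hneg l hl h
  let f₀ : Γ ⧸ L → V := Quotient.lift (fun γ => π γ • P) (by
    intro γ δ h
    obtain ⟨l, hl, hlγ⟩ := hL' (QuotientGroup.leftRel_apply.1 h)
    obtain rfl : δ = γ * i l := by rw [hlγ]; group
    simp [mul_smul, hπi, hl])
  have hf₀ : ∀ γ : Γ, f₀ (γ : Γ ⧸ L) = π γ • P := fun _ => rfl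
  let X : SimpleGraph (Γ ⧸ L) :=
    { Adj := fun x y => ∃ γ : Γ, ∃ δ ∈ S, x = (γ : Γ ⧸ L) ∧ y = ((γ * δ : Γ) : Γ ⧸ L)
      symm := ⟨by
        rintro x y ⟨γ, δ, hδ, rfl, rfl⟩
        exact ⟨γ * δ, δ⁻¹, hSinv δ hδ, rfl, by simp⟩⟩
      loopless := ⟨by
        rintro x ⟨γ, δ, hδ, rfl, h⟩
        have h1 : f₀ _ = f₀ _ := congrArg f₀ h
        rw [hf₀, hf₀, map_mul, mul_smul] at h1
        exact (hSadj δ hδ).ne (smul_left_cancel _ h1)⟩ }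
  let f : X →g T :=
    { toFun := f₀
      map_rel' := by
        rintro x y ⟨γ, δ, hδ, rfl, rfl⟩
        rw [hf₀, hf₀, map_mul, mul_smul]
        exact hadj _ _ _ (hSadj δ hδ) }
  have hX : X.Preconnected := by
    let R : Subgroup Γ :=
      { carrier := {γ | ∀ δ : Γ, X.Reachable (δ : Γ ⧸ L) ((δ * γ : Γ) : Γ ⧸ L)}
        one_mem' := fun δ => by rw [mul_one]
        mul_mem' := fun {a b} ha hb δ => by
          rw [← mul_assoc]; exact (ha δ).trans (hb _)
        inv_mem' := fun {a} ha δ => by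
          simpa using (ha (δ * a⁻¹)).symm }
    have hLR : L ≤ R := fun l hl δ => by
      rw [QuotientGroup.mk_mul_of_mem _ hl]
    have hSR : ∀ γ ∈ S, γ ∈ R := fun γ hγ δ =>
      SimpleGraph.Adj.reachable ⟨δ, γ, hγ, rfl, rfl⟩
    have hHR : componentStabilizer T P s ≤ (R.comap i).map (componentStabilizer T P s).subtype := by
      refine sup_le (fun g hg => ?_) ((Subgroup.closure_le _).2 fun g hg => ?_)
      · exact ⟨⟨g, hPH hg⟩, hLR (hL _ hg), rfl⟩
      · exact ⟨⟨g, mem_componentStabilizer_of_mem_steps hg⟩, hSR _ (Or.inl ⟨_, hg, rfl⟩), rfl⟩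
    have hR : R = ⊤ := by
      rw [eq_top_iff, ← hgen]
      refine sup_le ?_ ((Subgroup.zpowers_le).2 (hSR _ (Or.inr (Or.inl rfl))))
      rintro _ ⟨h, rfl⟩
      obtain ⟨h', hh', he⟩ := hHR h.2
      obtain rfl : h' = h := Subtype.ext he
      exact hh'
    intro x y
    induction x using QuotientGroup.induction_on with | H x => ?_
    induction y using QuotientGroup.induction_on with | H y => ?_
    have : x⁻¹ * y ∈ R := hR ▸ Subgroup.mem_top _
    simpa using this x
  have hfinj : Function.Injective f := by
    refine SimpleGraph.Hom.injective_of_locally_injective hX hT.isAcyclic f ?_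
    rintro x y z ⟨γ, δ, hδ, rfl, rfl⟩ ⟨γ', δ', hδ', h, rfl⟩ hyz
    obtain ⟨l, hl, hlγ⟩ := hL' (QuotientGroup.eq.1 h)
    obtain rfl : γ' = γ * i l := by rw [hlγ]; group
    change π (γ * δ) • P = π (γ * i l * δ') • P at hyz
    rw [map_mul, map_mul, map_mul, mul_smul, mul_smul, mul_smul, hπi] at hyz
    have := key δ hδ δ' hδ' l hl (smul_left_cancel _ hyz)
    refine QuotientGroup.eq.2 ?_
    convert this using 1
    group
  constructor
  · refine (injective_iff_map_eq_one π).2 fun γ hγ => ?_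
    have h1 : ((1 : Γ) : Γ ⧸ L) = (γ : Γ ⧸ L) := hfinj (by
      change π 1 • P = π γ • P
      rw [hγ, map_one])
    obtain ⟨l, -, hl⟩ := hL' (QuotientGroup.eq.1 h1)
    rw [inv_one, one_mul] at hl
    rw [← hl, hπi] at hγ
    rw [← hl, show l = 1 from Subtype.ext hγ, map_one]
  · refine MonoidHom.range_eq_top.1
      (eq_top_of_componentStabilizer_le (P := P) (s := s) hT.connected hadj hvert ?_ ⟨τ, hπτ⟩)
    exact fun h hh => ⟨i ⟨h, hh⟩, hπi _⟩

/-- In an infinite tree with a vertex-transitive action, the stabilizer of an inverted edge is not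
all of the component stabilizer. -/
theorem stabilizer_inf_ne_componentStabilizer [Infinite V] (hT : T.Connected)
    (hadj : ∀ (g : G) (x y : V), T.Adj x y → T.Adj (g • x) (g • y))
    (hvert : ∀ v w : V, ∃ g : G, g • v = w) (hs : s • s • P = P) :
    stabilizer G P ⊓ stabilizer G (s • P) ≠ componentStabilizer T P s := by
  intro heq
  have hfix : ∀ g ∈ componentStabilizer T P s, g • P = P ∧ g • s • P = s • P := fun g hg => by
    rw [← heq] at hg
    exact hg
  have hfix' : ∀ g : G, g • P = P → g • s • P = s • P := fun g hg =>
    (hfix g (stabilizer_le_componentStabilizer hg)).2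
  have hnbr : ∀ w, T.Adj P w → w = s • P := by
    intro w hw
    obtain ⟨g, rfl⟩ := hvert P w
    by_cases hg : g ∈ doubleCosets P s
    · obtain ⟨l, hl, m, hm, rfl | rfl⟩ := hg
      · rw [mul_smul, mul_smul, show m • P = P from hm, hfix' l hl]
      · rw [mul_smul, mul_smul, show m • P = P from hm, inv_smul_eq_iff.2 hs.symm, hfix' l hl]
    · have := (hfix g (mem_componentStabilizer_of_mem_steps ⟨hw, hg⟩)).1
      exact absurd this.symm hw.ne
  have hnbr' : ∀ w, T.Adj (s • P) w → w = P := by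
    intro w hw
    have := hadj s _ _ hw
    rw [hs] at this
    exact smul_left_cancel s (hnbr _ this)
  have hall : ∀ v, v = P ∨ v = s • P := by
    intro v
    induction (SimpleGraph.reachable_iff_reflTransGen P v).1 (hT.preconnected P v) with
    | refl => exact Or.inl rfl
    | tail _ h ih =>
      rcases ih with hb | hb <;> rw [hb] at h
      · exact Or.inr (hnbr _ h)
      · exact Or.inl (hnbr' _ h)
  have : (Set.univ : Set V).Finite :=
    (Set.toFinite {P, s • P}).subset fun v _ => hall v
  exact Set.infinite_univ this

end TreeAction

open TreeAction Pointwise in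
/-- An inverted edge gives an amalgam decomposition. -/
theorem splitsOver_of_inversion {V G : Type*} {T : SimpleGraph V}
    [Infinite V] (hT : T.IsTree) [Group G] [MulAction G V]
    (hadj : ∀ (g : G) (x y : V), T.Adj x y → T.Adj (g • x) (g • y))
    (hvert : ∀ v w : V, ∃ g : G, g • v = w) {P : V} {s : G} (hPs : T.Adj P (s • P))
    (hs : s • s • P = P) : SplitsOver G (stabilizer G P ⊓ stabilizer G (s • P)) := by
  set A := stabilizer G P ⊓ stabilizer G (s • P)
  let J := stabilizer G ({P, s • P} : Set V)
  have hmemJ : ∀ g, g ∈ J ↔ g ∈ A ∨ (g • P = s • P ∧ g • s • P = P) := by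
    intro g
    rw [mem_stabilizer_iff, Set.smul_set_insert, Set.smul_set_singleton, Set.pair_eq_pair_iff]
    rfl
  have hsJ : s ∈ J := (hmemJ s).2 (Or.inr ⟨rfl, hs⟩)
  have hAJ : A ≤ J := fun g hg => (hmemJ g).2 (Or.inl hg)
  have hAH : A ≤ componentStabilizer T P s := inf_le_left.trans stabilizer_le_componentStabilizer
  refine Or.inl ⟨componentStabilizer T P s, J, hAH, hAJ,
    stabilizer_inf_ne_componentStabilizer hT.connected hadj hvert hs, ?_, ?_⟩
  · intro h
    rw [← h] at hsJ
    exact hPs.ne hsJ.1.symm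
  set φ := fun b : Bool => Subgroup.inclusion
    (show A ≤ cond b (componentStabilizer T P s) J by cases b <;> assumption)
  let i : componentStabilizer T P s →* Monoid.PushoutI φ := Monoid.PushoutI.of (φ := φ) true
  let j : J →* Monoid.PushoutI φ := Monoid.PushoutI.of (φ := φ) false
  have hij : ∀ (a : G) (ha : a ∈ A), i ⟨a, hAH ha⟩ = j ⟨a, hAJ ha⟩ := fun a ha =>
    (Monoid.PushoutI.of_apply_eq_base φ true ⟨a, ha⟩).trans
      (Monoid.PushoutI.of_apply_eq_base φ false ⟨a, ha⟩).symm
  refine bijective_of_relations (P := P) (s := s) hT hadj hvert hPs _ i (j ⟨s, hsJ⟩)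
    ?_ ?_ ?_ ?_ (Or.inr ?_)
  · intro h
    exact Monoid.PushoutI.lift_of (φ := φ) (i := true) _ _ _ h
  · exact Monoid.PushoutI.lift_of (φ := φ) (i := false) _ _ _ ⟨s, hsJ⟩
  · set M := i.range ⊔ Subgroup.zpowers (j ⟨s, hsJ⟩)
    have hi : ∀ h, i h ∈ M := fun h => le_sup_left (a := i.range) ⟨h, rfl⟩
    have hτ : j ⟨s, hsJ⟩ ∈ M := le_sup_right (a := i.range) (Subgroup.mem_zpowers _)
    have hj : ∀ h, j h ∈ M := by
      rintro ⟨h, hh⟩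
      rcases (hmemJ h).1 hh with ha | ha
      · rw [← hij h ha]; exact hi _
      · have hb : s⁻¹ * h ∈ A := by
          refine Subgroup.mem_inf.2 ⟨?_, ?_⟩
          · simp [mem_stabilizer_iff, mul_smul, ha.1]
          · rw [mem_stabilizer_iff, mul_smul, ha.2, inv_smul_eq_iff, hs]
        have : (⟨h, hh⟩ : J) = ⟨s, hsJ⟩ * ⟨s⁻¹ * h, hAJ hb⟩ := Subtype.ext (by simp)
        rw [this, map_mul, ← hij _ hb]
        exact mul_mem hτ (hi _)
    refine eq_top_iff.2 fun γ _ => ?_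
    induction γ using Monoid.PushoutI.induction_on with
    | of b g =>
      cases b
      · exact hj g
      · exact hi g
    | base h =>
      rw [← Monoid.PushoutI.of_apply_eq_base φ true h]
      exact hi _
    | mul x y hx hy => exact mul_mem (hx trivial) (hy trivial)
  · rintro ⟨a, ha'⟩ ⟨b, hb'⟩ h1 h2 (rfl : b = _)
    have ha : a ∈ A := ⟨h1, h2⟩
    have hb : s⁻¹ * a * s ∈ A := by
      have h2' : a • s • P = s • P := h2
      have h1' : a • P = P := h1
      refine Subgroup.mem_inf.2 ⟨?_, ?_⟩
      · simp [mem_stabilizer_iff, mul_smul, h2']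
      · rw [mem_stabilizer_iff, mul_smul, mul_smul, hs, h1', inv_smul_eq_iff, hs]
    rw [hij a ha, hij _ hb, ← map_mul, ← map_mul]
    congr 1
    exact Subtype.ext (by simp [mul_assoc])
  · have ha : s * s ∈ A := by
      refine Subgroup.mem_inf.2 ⟨?_, ?_⟩
      · simp [mem_stabilizer_iff, mul_smul, hs]
      · simp [mem_stabilizer_iff, mul_smul, hs]
    exact ⟨⟨s * s, hAH ha⟩, ha.1, by rw [hij _ ha, ← map_mul]; rfl⟩

open TreeAction in
/-- An edge that is not inverted gives an HNN decomposition. -/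
theorem splitsOver_of_no_inversion {V G : Type*} {T : SimpleGraph V}
    (hT : T.IsTree) [Group G] [MulAction G V]
    (hadj : ∀ (g : G) (x y : V), T.Adj x y → T.Adj (g • x) (g • y))
    (hvert : ∀ v w : V, ∃ g : G, g • v = w) {P : V} {s : G} (hPs : T.Adj P (s • P))
    (hs : ∀ k : G, k • P = s • P → k • s • P ≠ P) :
    SplitsOver G (stabilizer G P ⊓ stabilizer G (s • P)) := by
  set A := stabilizer G P ⊓ stabilizer G (s • P)
  have hAH : A ≤ componentStabilizer T P s := inf_le_left.trans stabilizer_le_componentStabilizer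
  have hconj : A.map (MulAut.conj s⁻¹).toMonoidHom ≤ componentStabilizer T P s := by
    rintro _ ⟨a, ha, rfl⟩
    have h2 : a • s • P = s • P := ha.2
    refine stabilizer_le_componentStabilizer ?_
    simp [mem_stabilizer_iff, mul_smul, h2]
  let φ := (Subgroup.subgroupOfEquivOfLe hAH).trans
    ((A.equivMapOfInjective (MulAut.conj s⁻¹).toMonoidHom (MulAut.conj s⁻¹).injective).trans
      (Subgroup.subgroupOfEquivOfLe hconj).symm)
  have hφ : ∀ a, ((φ a : componentStabilizer T P s) : G) =
      s⁻¹ * ((a : componentStabilizer T P s) : G) * s⁻¹⁻¹ := fun _ => rfl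
  have hx : ∀ a : A.subgroupOf (componentStabilizer T P s),
      s⁻¹ * (componentStabilizer T P s).subtype ↑a =
        (componentStabilizer T P s).subtype ↑(φ a) * s⁻¹ := fun a => by
    rw [Subgroup.subtype_apply, Subgroup.subtype_apply, hφ]; group
  refine Or.inr ⟨componentStabilizer T P s, hAH, s⁻¹, hconj, φ, hφ, hx, ?_⟩
  refine bijective_of_relations (P := P) (s := s) hT hadj hvert hPs _
    HNNExtension.of (HNNExtension.t)⁻¹ ?_ ?_ ?_ ?_ (Or.inl hs)
  · intro h
    rw [HNNExtension.lift_of]; rfl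
  · rw [map_inv, HNNExtension.lift_t, inv_inv]
  · refine eq_top_iff.2 fun γ _ => ?_
    induction γ using HNNExtension.induction_on with
    | of g => exact le_sup_left (a := HNNExtension.of.range) ⟨g, rfl⟩
    | t =>
      exact inv_mem_iff.1
        (le_sup_right (a := HNNExtension.of.range) (Subgroup.mem_zpowers HNNExtension.t⁻¹))
    | mul x y hx hy => exact mul_mem (hx trivial) (hy trivial)
    | inv x hx => exact inv_mem (hx trivial)
  · intro a b h1 h2 hb
    have ha : a ∈ A.subgroupOf (componentStabilizer T P s) := ⟨h1, h2⟩
    have := HNNExtension.of_mul_inv_t (φ := φ) ⟨a, ha⟩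
    rw [show b = φ ⟨a, ha⟩ from Subtype.ext (by rw [hφ, hb, inv_inv])]
    exact this

/-- A group acting by automorphisms and vertex-transitively on an infinite tree splits
over the pointwise stabilizer of some edge. -/
theorem splits_of_transitive_action_on_tree {V G : Type*} (T : SimpleGraph V)
    [Infinite V] (hT : T.IsTree) [Group G] [MulAction G V]
    (hadj : ∀ (g : G) (x y : V), T.Adj x y → T.Adj (g • x) (g • y))
    (hvert : ∀ v w : V, ∃ g : G, g • v = w) :
    ∃ P Q : V, T.Adj P Q ∧ SplitsOver G (stabilizer G P ⊓ stabilizer G Q) := by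
  obtain ⟨P⟩ := hT.connected.nonempty
  obtain ⟨Q, hPQ⟩ : ∃ Q, T.Adj P Q := hT.connected.preconnected.exists_adj_of_nontrivial P
  refine ⟨P, Q, hPQ, ?_⟩
  by_cases h : ∃ s : G, s • P = Q ∧ s • Q = P
  · obtain ⟨s, rfl, hs⟩ := h
    exact splitsOver_of_inversion hT hadj hvert hPQ hs
  · obtain ⟨s, rfl⟩ := hvert P Q
    exact splitsOver_of_no_inversion hT hadj hvert hPQ fun k h1 h2 => h ⟨k, h1, h2⟩
end

section
/- Let G be a finitely generated infinite group which splits over a finite subgroup A. Then G has more than one end; that is, there exists a subset C ⊆ G such that C and G \ C are both infinite and Cg \ C = {cg : c ∈ C} \ C is finite for every g ∈ G. -/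
/-- The action of `G` on `G × Bool` by right translation on the first factor. -/
def rightTranslation (G : Type*) [Group G] : G →* Equiv.Perm (G × Bool) where
  toFun g :=
    { toFun := fun p => (p.1 * g⁻¹, p.2)
      invFun := fun p => (p.1 * g, p.2)
      left_inv := fun p => by simp
      right_inv := fun p => by simp }
  map_one' := by ext p <;> simp
  map_mul' g h := by ext p <;> simp [mul_assoc]

@[simp]
theorem rightTranslation_apply {G : Type*} [Group G] (g : G) (p : G × Bool) :
    rightTranslation G g p = (p.1 * g⁻¹, p.2) := rfl

open Classical in
/-- The permutation of `G × Bool` swapping the two sheets over `A`. -/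
noncomputable def sheetSwap {G : Type*} (A : Set G) : Equiv.Perm (G × Bool) where
  toFun p := (p.1, xor p.2 (decide (p.1 ∈ A)))
  invFun p := (p.1, xor p.2 (decide (p.1 ∈ A)))
  left_inv p := by simp
  right_inv p := by simp

open Classical in
@[simp]
theorem sheetSwap_apply {G : Type*} (A : Set G) (p : G × Bool) :
    sheetSwap A p = (p.1, xor p.2 (decide (p.1 ∈ A))) := rfl

@[simp]
theorem sheetSwap_inv {G : Type*} (A : Set G) : (sheetSwap A)⁻¹ = sheetSwap A := rfl

theorem sheetSwap_commute_rightTranslation {G : Type*} [Group G] (A : Subgroup G) {a : G}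
    (ha : a ∈ A) : Commute (sheetSwap (A : Set G)) (rightTranslation G a) := by
  ext p
  · simp
  · simp [A.mul_mem_cancel_right (A.inv_mem ha)]

/-- A set which changes only finitely under right translations by elements of `G`, and which is
neither finite nor cofinite, gives more than one end. -/
theorem exists_almostInvariant_set {G : Type*} [Group G] (F : G → Bool)
    (hF : ∀ g, {x | F (x * g) ≠ F x}.Finite)
    (htrue : {x | F x = true}.Infinite) (hfalse : {x | F x = false}.Infinite) :
    ∃ C : Set G, C.Infinite ∧ Cᶜ.Infinite ∧
      ∀ g : G, (((fun c => c * g) '' C) \ C).Finite := by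
  refine ⟨{x | F x = true}, htrue, ?_, fun g => ?_⟩
  · convert hfalse using 1
    ext x
    simp
  · refine ((hF g).image (· * g)).subset ?_
    rintro _ ⟨⟨x, hx, rfl⟩, hxg⟩
    refine ⟨x, ?_, rfl⟩
    simp only [Set.mem_ofPred_eq] at hx hxg ⊢
    rw [hx]
    exact hxg

/-- As `exists_almostInvariant_set`, where it suffices to know that each of the two level sets of
`F` contains all positive powers of some element of infinite order. -/
theorem exists_almostInvariant_set_of_pow {G : Type*} [Group G] (F : G → Bool)
    (hF : ∀ g, {x | F (x * g) ≠ F x}.Finite) {u v : G}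
    (hu : ∀ n, u ^ (n + 1) ≠ 1) (hv : ∀ n, v ^ (n + 1) ≠ 1)
    (hFu : ∀ n, F (u ^ (n + 1)) = F 1) (hFv : ∀ n, F (v ^ (n + 1)) = !F 1) :
    ∃ C : Set G, C.Infinite ∧ Cᶜ.Infinite ∧
      ∀ g : G, (((fun c => c * g) '' C) \ C).Finite := by
  have key : ∀ (w : G) (b : Bool), (∀ n, w ^ (n + 1) ≠ 1) → (∀ n, F (w ^ (n + 1)) = b) →
      {x | F x = b}.Infinite := by
    intro w b hw hb
    have hinj : Function.Injective fun n : ℕ => w ^ n := by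
      rw [injective_pow_iff_not_isOfFinOrder, isOfFinOrder_iff_pow_eq_one]
      rintro ⟨n, hn, h⟩
      obtain ⟨m, rfl⟩ := Nat.exists_eq_add_of_lt hn
      exact hw m (by simpa using h)
    exact Set.infinite_of_injective_forall_mem (f := fun n : ℕ => w ^ (n + 1))
      (fun m n h => by simpa using hinj h) hb
  have h1 := key u _ hu hFu
  have h2 := key v _ hv hFv
  cases h : F 1 <;> rw [h] at h1 h2
  · exact exists_almostInvariant_set F hF h2 h1
  · exact exists_almostInvariant_set F hF h1 h2

/-- An action of `G` on `G × Bool` lifting right translation, such that each element of a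
generating set preserves the sheets outside of finitely many fibres, yields an almost invariant
function `F : G → Bool`. -/
theorem exists_almostInvariant_of_action {G : Type*} [Group G] (ρ : G →* Equiv.Perm (G × Bool))
    {S : Set G} (hS : Subgroup.closure S = ⊤)
    (hfst : ∀ s ∈ S, ∀ p, (ρ s p).1 = p.1 * s⁻¹)
    (hsnd : ∀ s ∈ S, {x | ∃ e, (ρ s (x, e)).2 ≠ e}.Finite) :
    ∃ F : G → Bool, (∀ x g, F (x * g) = (ρ g⁻¹ (x, F x)).2) ∧
      ∀ g, {x | F (x * g) ≠ F x}.Finite := by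
  have key : ∀ g, (∀ p, (ρ g p).1 = p.1 * g⁻¹) ∧ {x | ∃ e, (ρ g (x, e)).2 ≠ e}.Finite := by
    intro g
    have hg : g ∈ Subgroup.closure S := hS ▸ Subgroup.mem_top g
    induction hg using Subgroup.closure_induction with
    | mem s hs => exact ⟨hfst s hs, hsnd s hs⟩
    | one => simp
    | mul g h _ _ ihg ihh =>
      refine ⟨fun p => by simp [ihg.1, ihh.1, mul_assoc], ?_⟩
      refine (ihh.2.union (ihg.2.preimage (f := (· * h⁻¹))
        (mul_left_injective _).injOn)).subset ?_
      rintro x ⟨e, he⟩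
      by_contra hx
      simp only [Set.mem_union, Set.mem_ofPred_eq, Set.mem_preimage, not_or, not_exists,
        not_not] at hx
      apply he
      have h1 : ρ h (x, e) = (x * h⁻¹, e) := Prod.ext (ihh.1 _) (hx.1 e)
      rw [map_mul, Equiv.Perm.mul_apply, h1, hx.2]
    | inv g _ ih =>
      have hinv : ∀ p, (ρ g⁻¹ p).1 = p.1 * g := fun p => by
        have := ih.1 (ρ g⁻¹ p)
        rw [← Equiv.Perm.mul_apply, ← map_mul, mul_inv_cancel, map_one,
          Equiv.Perm.one_apply] at this
        rw [this, inv_mul_cancel_right]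
      refine ⟨fun p => by rw [hinv, inv_inv], ?_⟩
      refine (ih.2.preimage (f := (· * g)) (mul_left_injective _).injOn).subset ?_
      rintro x ⟨e, he⟩
      refine ⟨(ρ g⁻¹ (x, e)).2, ?_⟩
      have h1 : (x * g, (ρ g⁻¹ (x, e)).2) = ρ g⁻¹ (x, e) := Prod.ext (hinv (x, e)).symm rfl
      rw [h1, ← Equiv.Perm.mul_apply, ← map_mul, mul_inv_cancel, map_one, Equiv.Perm.one_apply]
      exact he.symm
  have hmul : ∀ x g, (ρ (x * g)⁻¹ (1, false)).2 = (ρ g⁻¹ (x, (ρ x⁻¹ (1, false)).2)).2 := by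
    intro x g
    have h1 : ρ x⁻¹ (1, false) = (x, (ρ x⁻¹ (1, false)).2) :=
      Prod.ext (by rw [(key x⁻¹).1]; simp) rfl
    rw [← h1, mul_inv_rev, map_mul, Equiv.Perm.mul_apply]
  refine ⟨fun x => (ρ x⁻¹ (1, false)).2, hmul, fun g => (key g⁻¹).2.subset fun x hx => ?_⟩
  refine ⟨(ρ x⁻¹ (1, false)).2, ?_⟩
  rw [← hmul]
  exact hx

/-- The alternating product `s b * s (!b) * s b * ⋯` with `n` factors. -/
def altProd {G : Type*} [Monoid G] (s : Bool → G) : ℕ → Bool → G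
  | 0, _ => 1
  | n + 1, b => s b * altProd s n (!b)

theorem altProd_two_mul {G : Type*} [Monoid G] (s : Bool → G) (n : ℕ) (b : Bool) :
    altProd s (2 * n) b = (s b * s (!b)) ^ n := by
  induction n with
  | zero => simp [altProd]
  | succ n ih => rw [pow_succ', ← ih, mul_add_one]; simp [altProd, mul_assoc]

theorem altProd_two_mul_add_one {G : Type*} [Monoid G] (s : Bool → G) (n : ℕ) (b : Bool) :
    altProd s (2 * n + 1) b = (s b * s (!b)) ^ n * s b := by
  induction n with
  | zero => simp [altProd]
  | succ n ih => rw [pow_succ', mul_assoc, ← ih, mul_add_one]; simp [altProd, mul_assoc]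

open Monoid in
/-- In an amalgamated product of two groups, nonempty alternating products of elements outside
the amalgamated subgroup do not lie in the amalgamated subgroup. -/
theorem altProd_notMem_range_base {A : Type*} [Group A] {K : Bool → Type*} [∀ b, Group (K b)]
    {φ : ∀ b, A →* K b} (hφ : ∀ b, Function.Injective (φ b)) {k : ∀ b, K b}
    (hk : ∀ b, k b ∉ (φ b).range) (n : ℕ) (b : Bool) :
    altProd (fun b => PushoutI.of (φ := φ) b (k b)) (n + 1) b ∉ (PushoutI.base φ).range := by
  let l : ℕ → Bool → List (Σ b, K b) := Nat.rec (fun _ => []) fun _ f b => ⟨b, k b⟩ :: f (!b)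
  have hl : ∀ n b, ∀ x ∈ l n b, x.2 ∉ (φ x.1).range := by
    intro n
    induction n with
    | zero => simp [l]
    | succ n ih =>
      intro b x hx
      rcases List.mem_cons.1 hx with rfl | hx
      · exact hk b
      · exact ih _ x hx
  have hchain : ∀ n b, (l n b).IsChain fun x y => x.1 ≠ y.1 := by
    intro n
    induction n with
    | zero => simp [l]
    | succ n ih =>
      intro b
      cases n with
      | zero => simp [l]
      | succ n => exact List.IsChain.cons_cons (by simp) (ih _)
  let w : CoprodI.Word K :=
    { toList := l (n + 1) b
      ne_one := fun x hx h => hl (n + 1) b x hx (h ▸ one_mem _)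
      chain_ne := hchain (n + 1) b }
  have hprod : ∀ n b, ((l n b).map fun x => PushoutI.of (φ := φ) x.1 x.2).prod =
      altProd (fun b => PushoutI.of (φ := φ) b (k b)) n b := by
    intro n
    induction n with
    | zero => intro b; rfl
    | succ n ih => intro b; simpa [l, altProd] using ih (!b)
  intro hmem
  have hw : w = .empty := PushoutI.Reduced.eq_empty_of_mem_range hφ (w := w) (hl (n + 1) b) (by
    rw [← hprod] at hmem
    simpa [CoprodI.Word.prod, w, map_list_prod, Function.comp_def] using hmem)
  simpa [w, l, CoprodI.Word.empty] using congrArg CoprodI.Word.toList hw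

open Monoid in
theorem exists_almostInvariant_set_of_amalgam {G : Type*} [Group G] (A : Subgroup G) [Finite A]
    {H J : Subgroup G} (hH : A ≤ H) (hJ : A ≤ J) (hAH : A ≠ H) (hAJ : A ≠ J)
    (hbij : Function.Bijective (PushoutI.lift
      (φ := fun b : Bool => Subgroup.inclusion (show A ≤ cond b H J by cases b <;> assumption))
      (fun b : Bool => (cond b H J).subtype) A.subtype
      (by intro b; ext x; simp))) :
    ∃ C : Set G, C.Infinite ∧ Cᶜ.Infinite ∧
      ∀ g : G, (((fun c => c * g) '' C) \ C).Finite := by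
  classical
  let e := MulEquiv.ofBijective _ hbij
  have he_of : ∀ b (x : ↥(cond b H J)), e (PushoutI.of b x) = x := fun b x => by simp [e]
  have he_base : ∀ x : A, e (PushoutI.base _ x) = x := fun x => by simp [e]
  have hfin : (A : Set G).Finite := Set.toFinite _
  obtain ⟨h, hhH, hhA⟩ := SetLike.exists_of_lt (lt_of_le_of_ne hH hAH)
  obtain ⟨j, hjJ, hjA⟩ := SetLike.exists_of_lt (lt_of_le_of_ne hJ hAJ)
  let σ : Equiv.Perm (G × Bool) := sheetSwap (A : Set G)
  let f : ∀ b : Bool, ↥(cond b H J) →* Equiv.Perm (G × Bool) := fun b =>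
    ((MulAut.conj (cond b 1 σ)).toMonoidHom.comp (rightTranslation G)).comp (cond b H J).subtype
  let ρ : G →* Equiv.Perm (G × Bool) :=
    (PushoutI.lift f ((rightTranslation G).comp A.subtype) (by
      intro b
      refine MonoidHom.ext fun a => ?_
      cases b
      · have := (sheetSwap_commute_rightTranslation A a.2).eq
        simp only [f, MonoidHom.comp_apply]
        exact mul_inv_eq_of_eq_mul this
      · simp [f])).comp e.symm.toMonoidHom
  have hρ : ∀ b (x : ↥(cond b H J)), ρ x = f b x := fun b x => by
    have : e.symm x = PushoutI.of b x := by rw [MulEquiv.symm_apply_eq, he_of]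
    simp [ρ, this]
  have hρH : ∀ x ∈ H, ∀ p, ρ x p = (p.1 * x⁻¹, p.2) := fun x hx p => by
    rw [hρ true ⟨x, hx⟩]; simp [f]
  have hρJ : ∀ x ∈ J, ∀ p, ρ x p = (p.1 * x⁻¹,
      xor (xor p.2 (decide (p.1 ∈ A))) (decide (p.1 * x⁻¹ ∈ A))) := fun x hx p => by
    rw [hρ false ⟨x, hx⟩]; simp [f, σ]
  have hS : Subgroup.closure ((H : Set G) ∪ J) = ⊤ := by
    refine eq_top_iff.2 fun g _ => ?_
    obtain ⟨y, rfl⟩ := e.surjective g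
    induction y using PushoutI.induction_on with
    | of b x =>
      rw [he_of]
      refine Subgroup.subset_closure ?_
      cases b
      · exact Or.inr x.2
      · exact Or.inl x.2
    | base x => rw [he_base]; exact Subgroup.subset_closure (Or.inl (hH x.2))
    | mul x y hx hy => rw [map_mul]; exact mul_mem (hx trivial) (hy trivial)
  obtain ⟨F, hFmul, hF⟩ := exists_almostInvariant_of_action ρ hS
    (by
      rintro s (hs | hs) p
      · rw [hρH s hs]
      · rw [hρJ s hs])
    (by
      rintro s (hs | hs)
      · simp [hρH s hs]
      · refine (hfin.union (hfin.preimage (f := (· * s⁻¹)) (mul_left_injective _).injOn)).subset ?_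
        rintro x ⟨e, he⟩
        by_contra hx
        simp only [Set.mem_union, Set.mem_preimage, SetLike.mem_coe, not_or] at hx
        simp [hρJ s hs, hx] at he)
  let s : Bool → G := fun b => cond b h j
  have halt : ∀ n b, altProd s (n + 1) b ∉ A := by
    let k : ∀ b : Bool, ↥(cond b H J) := fun b => match b with
      | true => ⟨h, hhH⟩
      | false => ⟨j, hjJ⟩
    intro n b hmem
    refine altProd_notMem_range_base (k := k) (fun b => Subgroup.inclusion_injective _) ?_ n b
      ⟨⟨_, hmem⟩, e.injective ?_⟩
    · rintro (_ | _) ⟨a, ha⟩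
      · exact hjA ((show (a : G) = j from congrArg Subtype.val ha) ▸ a.2)
      · exact hhA ((show (a : G) = h from congrArg Subtype.val ha) ▸ a.2)
    · rw [he_base]
      have : ∀ n b, altProd s n b = e (altProd (fun b => PushoutI.of b (k b)) n b) := by
        intro n
        induction n with
        | zero => intro b; exact (map_one e).symm
        | succ n ih =>
          intro b
          rw [altProd, altProd, map_mul, he_of, ih]
          cases b <;> rfl
      exact this _ _
  have hodd : ∀ n b, (s b * s (!b)) ^ n * s b ∉ A := fun n b =>
    altProd_two_mul_add_one s n b ▸ halt _ _
  have heven : ∀ n b, (s b * s (!b)) ^ (n + 1) ∉ A := fun n b =>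
    altProd_two_mul s (n + 1) b ▸ halt _ _
  have hFh : ∀ x, F (x * h) = F x := fun x => by
    rw [hFmul, hρH _ (H.inv_mem hhH)]
  have hFj : ∀ x, F (x * j) = xor (xor (F x) (decide (x ∈ A))) (decide (x * j ∈ A)) := fun x => by
    rw [hFmul, hρJ _ (J.inv_mem hjJ)]
    simp
  refine exists_almostInvariant_set_of_pow F hF (u := h * j) (v := j * h)
    (fun n hn => heven n true (hn ▸ A.one_mem)) (fun n hn => heven n false (hn ▸ A.one_mem))
    (fun n => ?_) (fun n => ?_)
  · have step : ∀ n, F ((h * j) ^ (n + 1)) = F ((h * j) ^ n) := fun n => by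
      have h1 : (h * j) ^ n * h ∉ A := hodd n true
      have h2 : (h * j) ^ n * h * j ∉ A := by
        rw [mul_assoc, ← pow_succ]; exact heven n true
      rw [pow_succ, ← mul_assoc, hFj, hFh]
      simp [h1, h2]
    induction n with
    | zero => simpa using step 0
    | succ n ih => rw [step, ih]
  · induction n with
    | zero =>
      have h1 := hFj 1
      rw [one_mul] at h1
      rw [zero_add, pow_one, hFh, h1]
      simp [hjA, A.one_mem]
    | succ n ih =>
      have h1 : (j * h) ^ (n + 1) ∉ A := heven n false
      have h2 : (j * h) ^ (n + 1) * j ∉ A := hodd (n + 1) false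
      rw [pow_succ, ← mul_assoc, hFh, hFj, ih]
      simp [h1, h2]

theorem exists_almostInvariant_set_of_hnn {G : Type*} [Group G] (A : Subgroup G) [Finite A]
    {H B : Subgroup G} (hAH : A ≤ H) (t : G) (φ : A.subgroupOf H ≃* B.subgroupOf H)
    (hx : ∀ a : ↥(A.subgroupOf H), t * H.subtype ↑a = H.subtype ↑(φ a) * t)
    (hbij : Function.Bijective (HNNExtension.lift (φ := φ) H.subtype t hx)) :
    ∃ C : Set G, C.Infinite ∧ Cᶜ.Infinite ∧
      ∀ g : G, (((fun c => c * g) '' C) \ C).Finite := by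
  classical
  let e := MulEquiv.ofBijective _ hbij
  have he_of : ∀ x : H, e (HNNExtension.of x) = x := fun x => by simp [e]
  have he_t : e HNNExtension.t = t := by simp [e]
  have hfin : (A : Set G).Finite := Set.toFinite _
  let σ : Equiv.Perm (G × Bool) := sheetSwap (A : Set G)
  let ρ : G →* Equiv.Perm (G × Bool) :=
    (HNNExtension.lift ((rightTranslation G).comp H.subtype) (rightTranslation G t * σ) (by
      intro a
      have h1 := (sheetSwap_commute_rightTranslation A a.2).eq
      have h2 := congrArg (rightTranslation G) (hx a)
      rw [map_mul, map_mul] at h2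
      simp only [MonoidHom.comp_apply]
      rw [mul_assoc, ← mul_assoc _ _ σ, ← h2, mul_assoc]
      exact congrArg (rightTranslation G t * ·) h1)).comp e.symm.toMonoidHom
  have hρH : ∀ x ∈ H, ∀ p, ρ x p = (p.1 * x⁻¹, p.2) := fun x hx p => by
    have : e.symm x = HNNExtension.of ⟨x, hx⟩ := by rw [MulEquiv.symm_apply_eq, he_of]
    simp [ρ, this]
  have hsymm_t : e.symm t = HNNExtension.t := by rw [MulEquiv.symm_apply_eq, he_t]
  have hρt : ρ t = rightTranslation G t * σ := by simp [ρ, hsymm_t]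
  have hS : Subgroup.closure ((H : Set G) ∪ {t}) = ⊤ := by
    refine eq_top_iff.2 fun g _ => ?_
    obtain ⟨y, rfl⟩ := e.surjective g
    induction y using HNNExtension.induction_on with
    | of x => rw [he_of]; exact Subgroup.subset_closure (Or.inl x.2)
    | t => rw [he_t]; exact Subgroup.subset_closure (Or.inr rfl)
    | mul x y hx hy => rw [map_mul]; exact mul_mem (hx trivial) (hy trivial)
    | inv x hx => rw [map_inv]; exact inv_mem (hx trivial)
  obtain ⟨F, hFmul, hF⟩ := exists_almostInvariant_of_action ρ hS
    (by
      rintro s (hs | rfl) p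
      · rw [hρH s hs]
      · simp [hρt, σ])
    (by
      rintro s (hs | rfl)
      · simp [hρH s hs]
      · refine hfin.subset ?_
        rintro x ⟨e, he⟩
        by_contra hx
        rw [SetLike.mem_coe] at hx
        simp [hρt, σ, hx] at he)
  let ψ : G →* Multiplicative ℤ :=
    (HNNExtension.lift (φ := φ) 1 (Multiplicative.ofAdd 1) (by simp)).comp e.symm.toMonoidHom
  have hψA : ∀ a ∈ A, ψ a = 1 := fun a ha => by
    have : e.symm a = HNNExtension.of ⟨a, hAH ha⟩ := by rw [MulEquiv.symm_apply_eq, he_of]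
    simp [ψ, this]
  have hψt : ψ t = Multiplicative.ofAdd 1 := by simp [ψ, hsymm_t]
  have hpow : ∀ n : ℕ, t ^ (n + 1) ∉ A := fun n hn => by
    have h1 := hψA _ hn
    rw [map_pow, hψt, ← ofAdd_nsmul, ofAdd_eq_one] at h1
    simp at h1
    omega
  have hpow_inv : ∀ n : ℕ, t⁻¹ ^ (n + 1) ∉ A := fun n hn => by
    rw [inv_pow, inv_mem_iff] at hn
    exact hpow n hn
  have hFt : ∀ x, F (x * t) = xor (F x) (decide (x * t ∈ A)) := fun x => by
    rw [hFmul, map_inv, hρt, mul_inv_rev, ← map_inv, Equiv.Perm.mul_apply, rightTranslation_apply,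
      sheetSwap_inv, sheetSwap_apply, inv_inv, SetLike.mem_coe]
  have hFt_inv : ∀ x, F (x * t⁻¹) = xor (F x) (decide (x ∈ A)) := fun x => by
    have h1 := hFt (x * t⁻¹)
    rw [inv_mul_cancel_right] at h1
    rw [h1]
    simp
  refine exists_almostInvariant_set_of_pow F hF (u := t) (v := t⁻¹)
    (fun n hn => hpow n (hn ▸ A.one_mem)) (fun n hn => hpow_inv n (hn ▸ A.one_mem))
    (fun n => ?_) (fun n => ?_)
  · have step : ∀ n, F (t ^ (n + 1)) = F (t ^ n) := fun n => by
      have h1 : t ^ n * t ∉ A := pow_succ t n ▸ hpow n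
      rw [pow_succ, hFt]
      simp [h1]
    induction n with
    | zero => simpa using step 0
    | succ n ih => rw [step, ih]
  · induction n with
    | zero =>
      have h1 := hFt_inv 1
      rw [one_mul] at h1
      rw [zero_add, pow_one, h1]
      simp [A.one_mem]
    | succ n ih =>
      rw [pow_succ, hFt_inv, ih]
      simp only [hpow_inv n, decide_false, Bool.xor_false]

/-- A finitely generated infinite group which splits over a finite subgroup has more
than one end: there is a set `C ⊆ G` with `C` and `G \ C` infinite and `Cg \ C`
finite for every `g ∈ G`. -/
theorem more_than_one_end_of_splits {G : Type*} [Group G] [Group.FG G] [Infinite G]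
    (A : Subgroup G) (hA : Finite A) (h : SplitsOver G A) :
    ∃ C : Set G, C.Infinite ∧ Cᶜ.Infinite ∧
      ∀ g : G, (((fun c => c * g) '' C) \ C).Finite := by
  rcases h with ⟨H, J, hH, hJ, hAH, hAJ, hbij⟩ | ⟨H, hAH, t, -, φ, -, hx, hbij⟩
  · exact exists_almostInvariant_set_of_amalgam A hH hJ hAH hAJ hbij
  · exact exists_almostInvariant_set_of_hnn A hAH t φ hx hbij
end

section
/- Let G be a finitely generated group with more than one end; that is, assume there exists a subset C ⊆ G such that C and G \ C are both infinite and Cg \ C = {cg : c ∈ C} \ C is finite for every g ∈ G. Then G splits over some finite subgroup. -/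
namespace EndCuts

open scoped Pointwise

section Graph

variable {V ε : Type*} (s t : ε → V)

/-- The coboundary of a set `D` of vertices in the multigraph whose edges `e : ε` join `s e` to
`t e`: the edges with exactly one endpoint in `D`. -/
def coboundary (D : Set V) : Set ε := {e | ¬ (s e ∈ D ↔ t e ∈ D)}

/-- A vertex set with finite coboundary separating infinitely many vertices from infinitely many
others. -/
structure IsCut (D : Set V) : Prop where
  finite : (coboundary s t D).Finite
  infinite : D.Infinite
  infinite_compl : Dᶜ.Infinite

/-- A cut whose coboundary has the least possible number of edges. -/
structure IsMinCut (D : Set V) : Prop extends IsCut s t D where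
  le : ∀ E, IsCut s t E → (coboundary s t D).ncard ≤ (coboundary s t E).ncard

/-- A multigraph is connected if only trivial vertex sets have empty coboundary. -/
def IsConnected : Prop := ∀ D : Set V, coboundary s t D = ∅ → D = ∅ ∨ D = Set.univ

/-- Two sets are nested if one of the four corners they determine is empty. -/
def Nested (D E : Set V) : Prop := D ⊆ E ∨ E ⊆ D ∨ D ⊆ Eᶜ ∨ Dᶜ ⊆ E

variable {s t}

theorem coboundary_compl (D : Set V) : coboundary s t Dᶜ = coboundary s t D := by
  ext e; simp only [coboundary, Set.mem_ofPred_eq, Set.mem_compl_iff]; tauto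

theorem IsCut.compl {D : Set V} (h : IsCut s t D) : IsCut s t Dᶜ :=
  ⟨by rw [coboundary_compl]; exact h.finite, h.infinite_compl, by rw [compl_compl]; exact h.infinite⟩

theorem IsMinCut.compl {D : Set V} (h : IsMinCut s t D) : IsMinCut s t Dᶜ :=
  ⟨h.toIsCut.compl, by rw [coboundary_compl]; exact h.le⟩

theorem IsMinCut.nonempty {D : Set V} (h : IsMinCut s t D) : D.Nonempty := h.infinite.nonempty

theorem exists_isMinCut {C : Set V} (hC : IsCut s t C) : ∃ D, IsMinCut s t D := by
  obtain ⟨D, hD, hmin⟩ := (measure fun D : Set V => (coboundary s t D).ncard).wf.has_min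
    {D | IsCut s t D} ⟨C, hC⟩
  exact ⟨D, hD, fun E hE => not_lt.1 (hmin E hE)⟩

theorem coboundary_inter_subset (D E : Set V) :
    coboundary s t (D ∩ E) ⊆ coboundary s t D ∪ coboundary s t E := by
  intro e; simp only [coboundary, Set.mem_ofPred_eq, Set.mem_inter_iff, Set.mem_union]; tauto

theorem coboundary_union_subset (D E : Set V) :
    coboundary s t (D ∪ E) ⊆ coboundary s t D ∪ coboundary s t E := by
  intro e; simp only [coboundary, Set.mem_ofPred_eq, Set.mem_union]; tauto

/-- Submodularity of the size of the coboundary. -/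
theorem ncard_coboundary_inter_add_union {D E : Set V} (hD : (coboundary s t D).Finite)
    (hE : (coboundary s t E).Finite) :
    (coboundary s t (D ∩ E)).ncard + (coboundary s t (D ∪ E)).ncard ≤
      (coboundary s t D).ncard + (coboundary s t E).ncard := by
  have hI := (hD.union hE).subset (coboundary_inter_subset D E)
  have hU := (hD.union hE).subset (coboundary_union_subset D E)
  rw [← Set.ncard_union_add_ncard_inter _ _ hI hU, ← Set.ncard_union_add_ncard_inter _ _ hD hE]
  refine add_le_add (Set.ncard_le_ncard ?_ (hD.union hE))
    (Set.ncard_le_ncard ?_ (hD.subset Set.inter_subset_left))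
  · exact Set.union_subset (coboundary_inter_subset D E) (coboundary_union_subset D E)
  · intro e
    simp only [coboundary, Set.mem_ofPred_eq, Set.mem_union, Set.mem_inter_iff]; tauto

/-- If a pair of opposite corners of two minimal cuts is infinite, both are minimal cuts. -/
theorem IsMinCut.inter_union {D E : Set V} (hD : IsMinCut s t D) (hE : IsMinCut s t E)
    (h1 : (D ∩ E).Infinite) (h2 : (D ∪ E)ᶜ.Infinite) :
    IsMinCut s t (D ∩ E) ∧ IsMinCut s t (D ∪ E) := by
  have hI : IsCut s t (D ∩ E) :=
    ⟨(hD.finite.union hE.finite).subset (coboundary_inter_subset D E), h1,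
      hD.infinite_compl.mono (Set.compl_subset_compl.2 Set.inter_subset_left)⟩
  have hU : IsCut s t (D ∪ E) :=
    ⟨(hD.finite.union hE.finite).subset (coboundary_union_subset D E),
      hD.infinite.mono Set.subset_union_left, h2⟩
  have key := ncard_coboundary_inter_add_union hD.finite hE.finite
  have a1 := hD.le _ hI
  have a2 := hD.le _ hU
  have a3 := hE.le _ hI
  have a4 := hE.le _ hU
  exact ⟨⟨hI, fun F hF => (by omega : _ ≤ (coboundary s t D).ncard).trans (hD.le F hF)⟩,
    ⟨hU, fun F hF => (by omega : _ ≤ (coboundary s t D).ncard).trans (hD.le F hF)⟩⟩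

/-- The side of a minimal cut induces a connected subgraph. -/
theorem IsMinCut.eq_empty_or_eq (hconn : IsConnected s t) {D X : Set V} (hD : IsMinCut s t D)
    (hXD : X ⊆ D) (hX : coboundary s t X ⊆ coboundary s t D) : X = ∅ ∨ X = D := by
  have hY : coboundary s t (D \ X) ⊆ coboundary s t D := by
    intro e he
    have h1 : s e ∈ X → s e ∈ D := fun h => hXD h
    have h2 : t e ∈ X → t e ∈ D := fun h => hXD h
    have h3 : e ∈ coboundary s t X → e ∈ coboundary s t D := fun h => hX h
    simp only [coboundary, Set.mem_ofPred_eq, Set.mem_sdiff] at *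
    tauto
  have hdisj : Disjoint (coboundary s t X) (coboundary s t (D \ X)) := by
    rw [Set.disjoint_left]
    intro e he he'
    have h1 : s e ∈ X → s e ∈ D := fun h => hXD h
    have h2 : t e ∈ X → t e ∈ D := fun h => hXD h
    have h3 : e ∈ coboundary s t D := hX he
    simp only [coboundary, Set.mem_ofPred_eq, Set.mem_sdiff] at *
    tauto
  have hfX := hD.finite.subset hX
  have hfY := hD.finite.subset hY
  have hcard : (coboundary s t X).ncard + (coboundary s t (D \ X)).ncard ≤
      (coboundary s t D).ncard := by
    rw [← Set.ncard_union_eq hdisj hfX hfY]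
    exact Set.ncard_le_ncard (Set.union_subset hX hY) hD.finite
  have hDu : D ≠ Set.univ := fun h => by simpa [h] using hD.infinite_compl
  by_cases hinf : X.Infinite
  · have := hD.le X ⟨hfX, hinf, hD.infinite_compl.mono (Set.compl_subset_compl.2 hXD)⟩
    have h0 : coboundary s t (D \ X) = ∅ := (Set.ncard_eq_zero hfY).1 (by omega)
    rcases hconn _ h0 with h | h
    · exact Or.inr (hXD.antisymm (Set.sdiff_eq_empty.1 h))
    · exact (hDu (Set.univ_subset_iff.1 (h ▸ Set.sdiff_subset))).elim
  · have := hD.le (D \ X) ⟨hfY, hD.infinite.sdiff (Set.not_infinite.1 hinf),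
      hD.infinite_compl.mono (Set.compl_subset_compl.2 Set.sdiff_subset)⟩
    have h0 : coboundary s t X = ∅ := (Set.ncard_eq_zero hfX).1 (by omega)
    rcases hconn _ h0 with h | h
    · exact Or.inl h
    · exact (hDu (Set.univ_subset_iff.1 (h ▸ hXD))).elim

theorem IsMinCut.eq_or_eq_compl (hconn : IsConnected s t) {D E : Set V} (hD : IsMinCut s t D)
    (hE : IsMinCut s t E) (h : coboundary s t E = coboundary s t D) : E = D ∨ E = Dᶜ := by
  have key : ∀ {D E : Set V}, IsMinCut s t D → IsMinCut s t E →
      coboundary s t E = coboundary s t D → D ∩ E = ∅ ∨ E = D := by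
    intro D E hD hE h
    have hsub : coboundary s t (D ∩ E) ⊆ coboundary s t D := by
      simpa [h] using coboundary_inter_subset (s := s) (t := t) D E
    rcases hD.eq_empty_or_eq hconn Set.inter_subset_left hsub with h1 | h1
    · exact Or.inl h1
    rcases hE.eq_empty_or_eq hconn Set.inter_subset_right (h ▸ hsub) with h2 | h2
    · exact Or.inl h2
    · exact Or.inr (h2.symm.trans h1)
  rcases key hD hE h with h1 | h1
  · rcases key hD hE.compl (by rw [coboundary_compl, h]) with h2 | h2
    · obtain ⟨x, hx⟩ := hD.nonempty
      by_cases hxE : x ∈ E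
      · exact (h1.subset ⟨hx, hxE⟩).elim
      · exact (h2.subset ⟨hx, hxE⟩).elim
    · exact Or.inr (by rw [← h2, compl_compl])
  · exact Or.inl h1

/-- The vertices joined to `x` by a finite path avoiding the edges in `F`, where a path is seen
through its set of edges, which every set separating its ends has to cut. -/
def component (s t : ε → V) (F : Set ε) (x : V) : Set V :=
  {y | ∃ P : Set ε, P.Finite ∧ Disjoint P F ∧
    ∀ D : Set V, Disjoint P (coboundary s t D) → (x ∈ D ↔ y ∈ D)}

theorem mem_component_self (F : Set ε) (x : V) : x ∈ component s t F x :=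
  ⟨∅, Set.finite_empty, by simp, fun _ _ => Iff.rfl⟩

theorem coboundary_component_subset (F : Set ε) (x : V) :
    coboundary s t (component s t F x) ⊆ F := by
  intro e he
  by_contra heF
  apply he
  have aux : ∀ P : Set ε, Disjoint P F → Disjoint (insert e P) F := fun P hP => by
    rw [Set.disjoint_insert_left]; exact ⟨heF, hP⟩
  have aux' : ∀ (P : Set ε) (D : Set V), Disjoint (insert e P) (coboundary s t D) →
      Disjoint P (coboundary s t D) ∧ (s e ∈ D ↔ t e ∈ D) := fun P D hP => by
    rw [Set.disjoint_insert_left] at hP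
    exact ⟨hP.2, not_not.1 hP.1⟩
  constructor
  · rintro ⟨P, hPf, hPF, hP⟩
    exact ⟨insert e P, hPf.insert e, aux P hPF,
      fun D hD => (hP D (aux' P D hD).1).trans (aux' P D hD).2⟩
  · rintro ⟨P, hPf, hPF, hP⟩
    exact ⟨insert e P, hPf.insert e, aux P hPF,
      fun D hD => (hP D (aux' P D hD).1).trans (aux' P D hD).2.symm⟩

theorem IsConnected.exists_path (hconn : IsConnected s t) (x y : V) :
    ∃ P : Set ε, P.Finite ∧ ∀ D : Set V, Disjoint P (coboundary s t D) → (x ∈ D ↔ y ∈ D) := by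
  have h := hconn _ (Set.subset_empty_iff.1 (coboundary_component_subset (s := s) (t := t) ∅ x))
  have hy : y ∈ component s t ∅ x := by
    rcases h with h | h
    · exact (h.subset (mem_component_self (s := s) (t := t) ∅ x)).elim
    · rw [h]; trivial
  obtain ⟨P, hP, -, h⟩ := hy
  exact ⟨P, hP, h⟩

theorem finite_setOf_isMinCut_superset (hconn : IsConnected s t) {F : Set ε} (hF : F.Finite)
    (hFne : F.Nonempty) : {D | IsMinCut s t D ∧ F ⊆ coboundary s t D}.Finite := by
  by_cases hex : ∃ D₀, IsMinCut s t D₀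
  swap
  · convert Set.finite_empty
    exact Set.eq_empty_iff_forall_notMem.2 fun D hD => hex ⟨D, hD.1⟩
  obtain ⟨D₀, hD₀⟩ := hex
  have hk : ∀ D, IsMinCut s t D → (coboundary s t D).ncard = (coboundary s t D₀).ncard :=
    fun D hD => le_antisymm (hD.le _ hD₀.toIsCut) (hD₀.le _ hD.toIsCut)
  obtain ⟨n, hn⟩ : ∃ n, (coboundary s t D₀).ncard ≤ F.ncard + n := ⟨_, Nat.le_add_left _ _⟩
  induction n generalizing F with
  | zero =>
    have hEq : ∀ D, IsMinCut s t D ∧ F ⊆ coboundary s t D → coboundary s t D = F := fun D hD =>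
      (Set.eq_of_subset_of_ncard_le hD.2 (by rw [hk D hD.1]; exact hn) hD.1.finite).symm
    by_cases hne : ∃ D, IsMinCut s t D ∧ F ⊆ coboundary s t D
    · obtain ⟨D, hD⟩ := hne
      refine (Set.toFinite {D, Dᶜ}).subset fun E hE => ?_
      exact hD.1.eq_or_eq_compl hconn hE.1 (by rw [hEq _ hD, hEq _ hE])
    · convert Set.finite_empty
      exact Set.eq_empty_iff_forall_notMem.2 fun D hD => hne ⟨D, hD⟩
  | succ n ih =>
    obtain ⟨f, hf⟩ := hFne
    by_cases hsep : t f ∈ component s t F (s f)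
    · obtain ⟨P, hPf, hPF, hP⟩ := hsep
      have hfin : (⋃ e ∈ P, {D | IsMinCut s t D ∧ insert e F ⊆ coboundary s t D}).Finite := by
        refine hPf.biUnion fun e he => ih (hF.insert e) (Set.insert_nonempty _ _) ?_
        rw [Set.ncard_insert_of_notMem (Set.disjoint_left.1 hPF he) hF]
        omega
      refine hfin.subset fun D hD => ?_
      have : ¬ Disjoint P (coboundary s t D) := fun h => hD.2 hf (hP D h)
      obtain ⟨e, heP, heD⟩ := Set.not_disjoint_iff.1 this
      simp only [Set.mem_iUnion]
      exact ⟨e, heP, hD.1, Set.insert_subset heD hD.2⟩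
    · by_cases hle : (coboundary s t D₀).ncard ≤ F.ncard + n
      · exact ih hF ⟨f, hf⟩ hle
      by_cases hFk : F.ncard < (coboundary s t D₀).ncard
      swap
      · omega
      convert Set.finite_empty
      refine Set.eq_empty_iff_forall_notMem.2 fun D hD => ?_
      have hXF := coboundary_component_subset (s := s) (t := t) F (s f)
      have hsX := mem_component_self (s := s) (t := t) F (s f)
      set X := component s t F (s f)
      have hside : ∀ E, IsMinCut s t E → F ⊆ coboundary s t E → E ∩ X = ∅ ∨ E ∩ X = E :=
        fun E hE hFE => hE.eq_empty_or_eq hconn Set.inter_subset_left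
          ((coboundary_inter_subset E X).trans (Set.union_subset le_rfl (hXF.trans hFE)))
      have hXeq : ∀ E, IsMinCut s t E → F ⊆ coboundary s t E → s f ∈ E → False := by
        intro E hE hFE hsE
        have htE : t f ∈ Eᶜ := fun h => hFE hf ⟨fun _ => h, fun _ => hsE⟩
        have h1 : E ∩ X = E := (hside E hE hFE).resolve_left fun h => h.subset ⟨hsE, hsX⟩
        have h2 : Eᶜ ∩ X = ∅ := (hside Eᶜ hE.compl (by rwa [coboundary_compl])).resolve_right
          fun h => hsep (h.symm.subset htE).2
        have hEX : E = X := by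
          apply (Set.inter_eq_left.1 h1).antisymm
          intro x hx
          by_contra hxE
          exact h2.subset ⟨hxE, hx⟩
        have := Set.ncard_le_ncard hXF hF
        rw [← hEX, hk E hE] at this
        omega
      by_cases hsD : s f ∈ D
      · exact hXeq D hD.1 hD.2 hsD
      · exact hXeq Dᶜ hD.1.compl (by rw [coboundary_compl]; exact hD.2) hsD

theorem finite_setOf_isMinCut_of_not_disjoint (hconn : IsConnected s t) {P : Set ε}
    (hP : P.Finite) : {D | IsMinCut s t D ∧ ¬ Disjoint P (coboundary s t D)}.Finite := by
  refine (hP.biUnion fun e _ => finite_setOf_isMinCut_superset hconn (Set.finite_singleton e)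
    (Set.singleton_nonempty e)).subset fun D hD => ?_
  obtain ⟨e, heP, heD⟩ := Set.not_disjoint_iff.1 hD.2
  simp only [Set.mem_iUnion]
  exact ⟨e, heP, hD.1, Set.singleton_subset_iff.2 heD⟩

/-- Only finitely many minimal cuts separate two given vertices. -/
theorem finite_setOf_isMinCut_separating (hconn : IsConnected s t) (x y : V) :
    {D | IsMinCut s t D ∧ x ∈ D ∧ y ∉ D}.Finite := by
  obtain ⟨P, hPf, hP⟩ := hconn.exists_path x y
  refine (finite_setOf_isMinCut_of_not_disjoint hconn hPf).subset fun D hD => ⟨hD.1, fun h => ?_⟩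
  exact hD.2.2 ((hP D h).1 hD.2.1)

theorem Nested.symm {D E : Set V} (h : Nested D E) : Nested E D := by
  rcases h with h | h | h | h
  · exact Or.inr (Or.inl h)
  · exact Or.inl h
  · exact Or.inr (Or.inr (Or.inl (Set.subset_compl_comm.1 h)))
  · exact Or.inr (Or.inr (Or.inr (Set.compl_subset_comm.1 h)))

theorem Nested.compl_right {D E : Set V} (h : Nested D E) : Nested D Eᶜ := by
  rcases h with h | h | h | h
  · exact Or.inr (Or.inr (Or.inl (by rwa [compl_compl])))
  · exact Or.inr (Or.inr (Or.inr (Set.compl_subset_compl.2 h)))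
  · exact Or.inl h
  · exact Or.inr (Or.inl (Set.compl_subset_comm.1 h))

theorem Nested.compl_left {D E : Set V} (h : Nested D E) : Nested Dᶜ E := h.symm.compl_right.symm

/-- The minimal cuts crossing `D`. -/
def crossing (s t : ε → V) (D : Set V) : Set (Set V) := {E | IsMinCut s t E ∧ ¬ Nested D E}

theorem crossing_compl (D : Set V) : crossing s t Dᶜ = crossing s t D := by
  ext E
  refine and_congr_right fun _ => not_congr ⟨fun h => ?_, fun h => h.compl_left⟩
  simpa using h.compl_left

theorem finite_crossing (hconn : IsConnected s t) {D : Set V}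
    (hD : (coboundary s t D).Finite) : (crossing s t D).Finite := by
  by_cases hne : (coboundary s t D).Nonempty
  swap
  · rw [Set.not_nonempty_iff_eq_empty] at hne
    convert Set.finite_empty
    refine Set.eq_empty_iff_forall_notMem.2 fun E hE => hE.2 ?_
    rcases hconn D hne with rfl | rfl
    · exact Or.inl (Set.empty_subset _)
    · exact Or.inr (Or.inl (Set.subset_univ _))
  obtain ⟨e₀, -⟩ := hne
  choose P hPf hP using hconn.exists_path (s e₀)
  refine (finite_setOf_isMinCut_of_not_disjoint hconn (P := ⋃ e ∈ coboundary s t D,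
    P (s e) ∪ P (t e)) (hD.biUnion fun e _ => (hPf _).union (hPf _))).subset fun E hE => ?_
  refine ⟨hE.1, fun hdisj => hE.2 ?_⟩
  have hsame : ∀ e ∈ coboundary s t D, (s e₀ ∈ E ↔ s e ∈ E) ∧ (s e₀ ∈ E ↔ t e ∈ E) := by
    intro e he
    have := hdisj.mono_left (Set.subset_biUnion_of_mem (u := fun e => P (s e) ∪ P (t e)) he)
    rw [Set.disjoint_union_left] at this
    exact ⟨hP _ _ this.1, hP _ _ this.2⟩
  have key : ∀ E, IsMinCut s t E → s e₀ ∉ E →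
      (∀ e ∈ coboundary s t D, (s e₀ ∈ E ↔ s e ∈ E) ∧ (s e₀ ∈ E ↔ t e ∈ E)) → Nested D E := by
    intro E hE h0 hE'
    have hsub : coboundary s t (E ∩ D) ⊆ coboundary s t E := by
      intro e he
      have := hE' e
      simp only [coboundary, Set.mem_ofPred_eq, Set.mem_inter_iff] at *
      tauto
    rcases hE.eq_empty_or_eq hconn Set.inter_subset_left hsub with h | h
    · exact Or.inr (Or.inr (Or.inl fun x hx hxE => h.subset ⟨hxE, hx⟩))
    · exact Or.inr (Or.inl (Set.inter_eq_left.1 h))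
  by_cases h0 : s e₀ ∈ E
  · simpa using (key Eᶜ hE.1.compl (by simpa using h0) fun e he => by
      simpa [not_iff_not] using hsame e he).compl_right
  · exact key E hE.1 h0 hsame

theorem ncard_crossing_inter_add_union_lt (hconn : IsConnected s t) {D E : Set V}
    (hD : IsMinCut s t D) (hE : IsMinCut s t E) (hDE : ¬ Nested D E) :
    (crossing s t (D ∩ E)).ncard + (crossing s t (D ∪ E)).ncard <
      (crossing s t D).ncard + (crossing s t E).ncard := by
  have hfD := finite_crossing hconn hD.finite
  have hfE := finite_crossing hconn hE.finite
  have hfI := finite_crossing hconn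
    ((hD.finite.union hE.finite).subset (coboundary_inter_subset D E))
  have hfU := finite_crossing hconn
    ((hD.finite.union hE.finite).subset (coboundary_union_subset D E))
  rw [← Set.ncard_union_add_ncard_inter _ _ hfI hfU, ← Set.ncard_union_add_ncard_inter _ _ hfD hfE]
  have hI : ∀ F, Nested D F → Nested (D ∩ E) F ∨ Nested (D ∪ E) F := by
    rintro F (h | h | h | h)
    · exact Or.inl (Or.inl (Set.inter_subset_left.trans h))
    · exact Or.inr (Or.inr (Or.inl (h.trans Set.subset_union_left)))
    · exact Or.inl (Or.inr (Or.inr (Or.inl (Set.inter_subset_left.trans h))))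
    · exact Or.inr (Or.inr (Or.inr (Or.inr
        ((Set.compl_subset_compl.2 Set.subset_union_left).trans h))))
  have hI' : ∀ F, Nested E F → Nested (D ∩ E) F ∨ Nested (D ∪ E) F := by
    rintro F (h | h | h | h)
    · exact Or.inl (Or.inl (Set.inter_subset_right.trans h))
    · exact Or.inr (Or.inr (Or.inl (h.trans Set.subset_union_right)))
    · exact Or.inl (Or.inr (Or.inr (Or.inl (Set.inter_subset_right.trans h))))
    · exact Or.inr (Or.inr (Or.inr (Or.inr
        ((Set.compl_subset_compl.2 Set.subset_union_right).trans h))))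
  have hb : ∀ F, Nested D F → Nested E F → Nested (D ∩ E) F ∧ Nested (D ∪ E) F := by
    intro F h1 h2
    have hDE' := hDE
    simp only [Nested, Set.subset_def, Set.mem_compl_iff, Set.mem_inter_iff, Set.mem_union]
      at h1 h2 hDE' ⊢
    constructor
    · rcases h1 with h | h | h | h <;> rcases h2 with h' | h' | h' | h' <;> grind
    · rcases h1 with h | h | h | h <;> rcases h2 with h' | h' | h' | h' <;> grind
  have hlt : (crossing s t (D ∩ E) ∪ crossing s t (D ∪ E)).ncard <
      (crossing s t D ∪ crossing s t E).ncard := by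
    refine Set.ncard_lt_ncard (Set.ssubset_iff_of_subset ?_ |>.2 ⟨D, Or.inr ⟨hD, fun h =>
      hDE h.symm⟩, ?_⟩) (hfD.union hfE)
    · rintro F (⟨hF, h⟩ | ⟨hF, h⟩) <;>
      · by_contra hcon
        simp only [crossing, Set.mem_union, Set.mem_ofPred_eq, not_or, not_and, not_not] at hcon
        have := hb F (hcon.1 hF) (hcon.2 hF)
        tauto
    · rintro (⟨-, h⟩ | ⟨-, h⟩)
      · exact h (Or.inl Set.inter_subset_left)
      · exact h (Or.inr (Or.inl Set.subset_union_left))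
  refine add_lt_add_of_lt_of_le hlt (Set.ncard_le_ncard ?_ (hfD.subset Set.inter_subset_left))
  rintro F ⟨⟨hF, h1⟩, -, h2⟩
  exact ⟨⟨hF, fun h => (hI F h).elim h1 h2⟩, ⟨hF, fun h => (hI' F h).elim h1 h2⟩⟩

/-- Minimal cuts crossing as few minimal cuts as possible are pairwise nested. -/
theorem nested_of_ncard_crossing_minimal (hconn : IsConnected s t) {D E : Set V}
    (hD : IsMinCut s t D) (hE : IsMinCut s t E)
    (hmin : ∀ F, IsMinCut s t F → (crossing s t D).ncard ≤ (crossing s t F).ncard)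
    (hDE : (crossing s t E).ncard = (crossing s t D).ncard) : Nested D E := by
  have key : ∀ E, IsMinCut s t E → (crossing s t E).ncard = (crossing s t D).ncard →
      (D ∩ E).Infinite → (D ∪ E)ᶜ.Infinite → Nested D E := by
    intro E hE hDE h1 h2
    by_contra hn
    have h := hD.inter_union hE h1 h2
    have := ncard_crossing_inter_add_union_lt hconn hD hE hn
    have := hmin _ h.1
    have := hmin _ h.2
    omega
  have split : ∀ A B : Set V, A.Infinite → (A ∩ B).Infinite ∨ (A ∩ Bᶜ).Infinite := by
    intro A B hA
    rw [← Set.infinite_union, Set.inter_union_compl]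
    exact hA
  by_cases h : (D ∩ E).Infinite ∧ (D ∪ E)ᶜ.Infinite
  · exact key E hE hDE h.1 h.2
  · have h' : (D ∩ Eᶜ).Infinite ∧ (D ∪ Eᶜ)ᶜ.Infinite := by
      rw [Set.compl_union, compl_compl]
      rw [Set.compl_union] at h
      rw [not_and_or] at h
      rcases h with h | h
      · refine ⟨(split D E hD.infinite).resolve_left h, ?_⟩
        have := (split E D hE.infinite).resolve_left (by rwa [Set.inter_comm])
        rwa [Set.inter_comm]
      · refine ⟨?_, (split _ E hD.infinite_compl).resolve_right h⟩
        have := (split _ D hE.infinite_compl).resolve_right (by rwa [Set.inter_comm])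
        rwa [Set.inter_comm]
    simpa using (key Eᶜ hE.compl (by rw [crossing_compl, hDE]) h'.1 h'.2).compl_right

end Graph

section PingPong

variable {G X : Type*} [Group G] [MulAction G X]

theorem smul_set_ssubset_smul_set_iff {a : G} {A B : Set X} : a • A ⊂ a • B ↔ A ⊂ B := by
  simp only [ssubset_iff_subset_not_subset, Set.smul_set_subset_smul_set_iff]

/-- A ping-pong criterion for the injectivity of a homomorphism from an amalgamated product. -/
theorem injective_of_pushoutI_pingPong {A : Type*} [Group A] {K : Bool → Type*} [∀ b, Group (K b)]
    {φ : ∀ b, A →* K b} (hφ : ∀ b, Function.Injective (φ b)) {C : Set X} (hC : C.Nonempty)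
    (hCc : Cᶜ.Nonempty) (f : Monoid.PushoutI φ →* G)
    (hinj : ∀ a, f (Monoid.PushoutI.base φ a) = 1 → a = 1)
    (hA : ∀ a, f (Monoid.PushoutI.base φ a) • C = C)
    (htrue : ∀ h : K true, h ∉ (φ true).range → f (Monoid.PushoutI.of true h) • C ⊂ Cᶜ)
    (hfalse : ∀ h : K false, h ∉ (φ false).range → f (Monoid.PushoutI.of false h) • Cᶜ ⊆ C) :
    Function.Injective f := by
  classical
  obtain ⟨d⟩ := Monoid.PushoutI.NormalWord.transversal_nonempty _ hφ
  have hAc : ∀ a, f (Monoid.PushoutI.base φ a) • Cᶜ = Cᶜ := fun a => by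
    rw [Set.smul_set_compl, hA a]
  have key : ∀ w : Monoid.PushoutI.NormalWord d, ∃ c : Bool,
      (w.fstIdx = some true → f w.prod • (cond c C Cᶜ) ⊂ Cᶜ) ∧
      (w.fstIdx = some false → f w.prod • (cond c C Cᶜ) ⊂ C ∨ f w.prod • Cᶜ ⊆ C) := by
    intro w
    induction w using Monoid.PushoutI.NormalWord.consRecOn with
    | empty => exact ⟨true, by simp [Monoid.CoprodI.Word.fstIdx]⟩
    | base a w hw ih =>
      obtain ⟨c, h1, h2⟩ := ih
      have hidx : ∀ b, (Monoid.PushoutI.base φ a • w).fstIdx =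
          some b → w.fstIdx = some b := by
        intro b hb
        rwa [Monoid.PushoutI.NormalWord.base_smul_def] at hb
      refine ⟨c, fun h => ?_, fun h => ?_⟩
      · have := smul_set_ssubset_smul_set_iff (a := f (Monoid.PushoutI.base φ a)) |>.2 (h1 (hidx _ h))
        rw [hAc a] at this
        rwa [Monoid.PushoutI.NormalWord.prod_smul, map_mul, mul_smul]
      · rw [Monoid.PushoutI.NormalWord.prod_smul, map_mul, mul_smul, mul_smul]
        refine (h2 (hidx _ h)).imp (fun h => ?_) (fun h => ?_)
        · have := smul_set_ssubset_smul_set_iff (a := f (Monoid.PushoutI.base φ a)) |>.2 h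
          rwa [hA a] at this
        · have := Set.smul_set_mono (a := f (Monoid.PushoutI.base φ a)) h
          rwa [hA a] at this
    | cons i g w hmw _ hgr hw ih =>
      have hidx : (Monoid.PushoutI.NormalWord.cons g w hmw hgr).fstIdx = some i := rfl
      rw [hidx, Monoid.PushoutI.NormalWord.prod_cons, map_mul]
      rcases hidx' : w.fstIdx with _ | b
      · have hprod : w.prod = 1 := by
          have hl : w.toWord = Monoid.CoprodI.Word.empty := by
            ext1
            simpa [Monoid.CoprodI.Word.fstIdx] using hidx'
          simp [Monoid.PushoutI.NormalWord.prod, hw, hl]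
        rw [hprod, map_one, mul_one]
        refine ⟨true, fun h => ?_, fun h => ?_⟩
        · obtain rfl : i = true := by simpa using h
          exact htrue g hgr
        · obtain rfl : i = false := by simpa using h
          exact Or.inr (hfalse g hgr)
      · obtain ⟨c, h1, h2⟩ := ih
        have hib : b ≠ i := by rintro rfl; exact hmw hidx'
        cases i with
        | true =>
          obtain rfl : b = false := by simpa using hib
          rcases h2 hidx' with h | h
          · refine ⟨c, fun _ => ?_, by simp⟩
            rw [mul_smul]
            exact (smul_set_ssubset_smul_set_iff.2 h).trans (htrue g hgr)
          · refine ⟨false, fun _ => ?_, by simp⟩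
            rw [mul_smul]
            exact (Set.smul_set_mono h).trans_ssubset (htrue g hgr)
        | false =>
          obtain rfl : b = true := by simpa using hib
          refine ⟨c, by simp, fun _ => Or.inl ?_⟩
          rw [mul_smul]
          exact (smul_set_ssubset_smul_set_iff.2 (h1 hidx')).trans_subset (hfalse g hgr)
  refine (injective_iff_map_eq_one f).2 fun x hx => ?_
  obtain ⟨w, rfl⟩ := (Monoid.PushoutI.NormalWord.equiv (d := d)).symm.surjective x
  change f w.prod = 1 at hx
  change w.prod = 1
  obtain ⟨c, h1, h2⟩ := key w
  rw [hx, one_smul] at h1 h2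
  rw [one_smul] at h2
  rcases hidx : w.fstIdx with _ | b
  · have hl : w.toWord = Monoid.CoprodI.Word.empty := by
      ext1
      simpa [Monoid.CoprodI.Word.fstIdx] using hidx
    have hprod : w.prod = Monoid.PushoutI.base _ w.head := by
      simp [Monoid.PushoutI.NormalWord.prod, hl]
    rw [hprod] at hx
    rw [hprod, hinj _ hx, map_one]
  · exfalso
    obtain ⟨x, hx⟩ := hC
    obtain ⟨y, hy⟩ := hCc
    cases b with
    | true =>
      have h := h1 hidx
      cases c with
      | true => exact h.subset hx hx
      | false => exact h.ne rfl
    | false =>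
      rcases h2 hidx with h | h
      · cases c with
        | true => exact h.ne rfl
        | false => exact hy (h.subset hy)
      · exact hy (h hy)

/-- A ping-pong criterion for the injectivity of a homomorphism from an HNN extension. -/
theorem injective_of_hnnExtension_pingPong {H : Type*} [Group H] {A B : Subgroup H} {φ : A ≃* B}
    (P : ℤˣ → Set X) (f : HNNExtension H A B φ →* G)
    (hinj : ∀ h, f (HNNExtension.of h) = 1 → h = 1)
    (ht : ∀ u : ℤˣ, f HNNExtension.t ^ (u : ℤ) • (P (-u))ᶜ ⊆ P u)
    (hsame : ∀ u, ∀ h : H, f (HNNExtension.of h) • P u ⊆ (P (-u))ᶜ)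
    (hneg : ∀ u, ∀ h ∉ HNNExtension.toSubgroup A B (-u),
      f (HNNExtension.of h) • P u ⊆ (P u)ᶜ)
    (hne : ∀ u v, ∀ h : H, ¬ f (HNNExtension.of h) • (P u)ᶜ ⊆ P v) :
    Function.Injective f := by
  obtain ⟨d⟩ := HNNExtension.NormalWord.TransversalPair.nonempty H A B
  have key : ∀ w : HNNExtension.NormalWord d, ∀ v ∈ w.toList.head?.map Prod.fst, ∃ (k : H) (u : ℤˣ),
      f (w.prod φ) • f (HNNExtension.of k) • (P u)ᶜ ⊆ f (HNNExtension.of w.head) • P v := by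
    intro w
    induction w using HNNExtension.NormalWord.consRecOn with
    | ofGroup g => simp [HNNExtension.NormalWord.ofGroup]
    | cons g u w h1 h2 ih =>
      intro v hv
      obtain rfl : u = v := by simpa [HNNExtension.NormalWord.cons] using hv
      rw [HNNExtension.NormalWord.prod_cons, map_mul, map_mul, map_zpow]
      change ∃ (k : H) (u' : ℤˣ), _ ⊆ f (HNNExtension.of g) • P u
      simp only [mul_smul, Set.smul_set_subset_smul_set_iff]
      rcases hl : w.toList.head?.map Prod.fst with _ | v
      · have hprod : w.prod φ = HNNExtension.of w.head := by
          have : w.toList = [] := by simpa using hl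
          simp [HNNExtension.NormalWord.ReducedWord.prod, this]
        refine ⟨w.head⁻¹, -u, ?_⟩
        rw [hprod, ← mul_smul (f _) (f _), ← map_mul, ← map_mul, mul_inv_cancel, map_one, map_one,
          one_smul]
        exact ht u
      · obtain ⟨k, u', hk⟩ := ih v hl
        refine ⟨k, u', (Set.smul_set_mono (hk.trans ?_)).trans (ht u)⟩
        rcases eq_or_ne v u with rfl | hvu
        · exact hsame _ _
        · obtain rfl : v = -u := Int.units_ne_iff_eq_neg.1 hvu
          refine hneg _ _ fun hmem => ?_
          rw [neg_neg] at hmem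
          exact hvu (h2 _ hl hmem).symm
  refine (injective_iff_map_eq_one f).2 fun x hx => ?_
  obtain ⟨w, rfl⟩ := (HNNExtension.NormalWord.equiv φ d).symm.surjective x
  change f (w.prod φ) = 1 at hx
  change w.prod φ = 1
  rcases hl : w.toList.head?.map Prod.fst with _ | v
  · have hprod : w.prod φ = HNNExtension.of w.head := by
      have : w.toList = [] := by simpa using hl
      simp [HNNExtension.NormalWord.ReducedWord.prod, this]
    rw [hprod] at hx
    rw [hprod, hinj _ hx, map_one]
  · obtain ⟨k, u, hk⟩ := key w v hl
    rw [hx, one_smul, Set.subset_smul_set_iff, ← map_inv, ← map_inv, ← mul_smul (f _) (f _),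
      ← map_mul, ← map_mul] at hk
    exact (hne _ _ _ hk).elim

end PingPong

section TreeSet

variable {G X : Type*} [Group G] [MulAction G X]

/-- The half-spaces of a tree: a system of pairwise nested sets closed under complements such that
only finitely many of them separate two given points. -/
structure IsTreeSet (T : Set (Set X)) : Prop where
  compl_mem : ∀ D ∈ T, Dᶜ ∈ T
  nonempty : ∀ D ∈ T, D.Nonempty
  nested : ∀ D ∈ T, ∀ E ∈ T, Nested D E
  finite : ∀ x y, {D | D ∈ T ∧ x ∈ D ∧ y ∉ D}.Finite

/-- `D` is a maximal element of the system `T` properly contained in `E`. -/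
structure Covered (T : Set (Set X)) (D E : Set X) : Prop where
  left_mem : D ∈ T
  right_mem : E ∈ T
  ssubset : D ⊂ E
  eq_or_eq : ∀ F ∈ T, D ⊆ F → F ⊆ E → F = D ∨ F = E

/-- Two half-spaces `D` and `E` bounded by edges with a common vertex lying in neither. -/
def Cobounded (T : Set (Set X)) (D E : Set X) : Prop := D = E ∨ Covered T D Eᶜ

variable {T : Set (Set X)}

theorem IsTreeSet.compl_nonempty (hT : IsTreeSet T) {D : Set X} (hD : D ∈ T) : Dᶜ.Nonempty :=
  hT.nonempty _ (hT.compl_mem _ hD)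

theorem Covered.compl (hT : IsTreeSet T) {D E : Set X} (h : Covered T D E) : Covered T Eᶜ Dᶜ where
  left_mem := hT.compl_mem _ h.right_mem
  right_mem := hT.compl_mem _ h.left_mem
  ssubset := compl_lt_compl_iff_lt.2 h.ssubset
  eq_or_eq F hF h1 h2 := by
    rcases h.eq_or_eq Fᶜ (hT.compl_mem _ hF) (Set.subset_compl_comm.1 h2)
      (Set.compl_subset_comm.1 h1) with h | h
    · exact Or.inr (by rw [← h, compl_compl])
    · exact Or.inl (by rw [← h, compl_compl])

theorem Covered.eq_or_covered_compl (hT : IsTreeSet T) {D D' E : Set X} (h : Covered T D E)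
    (h' : Covered T D' E) : D = D' ∨ Covered T D D'ᶜ := by
  have hEc := hT.compl_nonempty h.right_mem
  have key : ∀ {D D'}, Covered T D E → Covered T D' E → D ⊆ D' → D = D' := fun h h' hs =>
    ((h.eq_or_eq _ h'.left_mem hs h'.ssubset.subset).resolve_right h'.ssubset.ne).symm
  have hnc : ∀ {D D'}, Covered T D E → Covered T D' E → ¬ D'ᶜ ⊆ D := fun h h' hs => by
    obtain ⟨x, hx⟩ := hEc
    exact hx (h.ssubset.subset (hs fun hx' => hx (h'.ssubset.subset hx')))
  rcases hT.nested D h.left_mem D' h'.left_mem with hs | hs | hs | hs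
  · exact Or.inl (key h h' hs)
  · exact Or.inl (key h' h hs).symm
  · refine Or.inr ⟨h.left_mem, hT.compl_mem _ h'.left_mem,
      ⟨hs, hnc h h'⟩, fun F hF h1 h2 => ?_⟩
    obtain ⟨x, hx⟩ := hT.nonempty _ h'.left_mem
    obtain ⟨y, hy⟩ := hT.nonempty _ h.left_mem
    rcases hT.nested F hF E h.right_mem with hFE | hFE | hFE | hFE
    · rcases h.eq_or_eq F hF h1 hFE with rfl | rfl
      · exact Or.inl rfl
      · exact (h2 (h'.ssubset.subset hx) hx).elim
    · exact (h2 (hFE (h'.ssubset.subset hx)) hx).elim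
    · exact (hFE (h1 hy) (h.ssubset.subset hy)).elim
    · rcases h'.eq_or_eq Fᶜ (hT.compl_mem _ hF) (Set.subset_compl_comm.1 h2) hFE with hF' | hF'
      · exact Or.inr (by rw [← hF', compl_compl])
      · exact ((hF'.symm.subset (h.ssubset.subset hy)) (h1 hy)).elim
  · exact (hnc h' h hs).elim

theorem Cobounded.symm (hT : IsTreeSet T) {D E : Set X} (h : Cobounded T D E) :
    Cobounded T E D := by
  rcases h with rfl | h
  · exact Or.inl rfl
  · exact Or.inr (by simpa using h.compl hT)

theorem Cobounded.trans (hT : IsTreeSet T) {D E F : Set X} (h : Cobounded T D E)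
    (h' : Cobounded T E F) : Cobounded T D F := by
  rcases h with rfl | h
  · exact h'
  rcases h'.symm hT with rfl | h'
  · exact Or.inr h
  · exact h.eq_or_covered_compl hT h'

theorem Cobounded.smul (hinv : ∀ (g : G), ∀ D ∈ T, g • D ∈ T) {D E : Set X}
    (h : Cobounded T D E) (g : G) : Cobounded T (g • D) (g • E) := by
  rcases h with rfl | h
  · exact Or.inl rfl
  · refine Or.inr ⟨hinv g _ h.left_mem, by rw [← Set.smul_set_compl]; exact hinv g _ h.right_mem,
      by rw [← Set.smul_set_compl]; exact smul_set_ssubset_smul_set_iff.2 h.ssubset,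
      fun F hF h1 h2 => ?_⟩
    rw [← Set.smul_set_compl] at h2 ⊢
    rw [Set.smul_set_subset_iff_subset_inv_smul_set] at h1
    rw [Set.subset_smul_set_iff] at h2
    simpa only [inv_smul_eq_iff] using h.eq_or_eq _ (hinv g⁻¹ F hF) h1 h2

/-- Between two nested half-spaces there is one covered by the larger one. -/
theorem IsTreeSet.exists_covered (hT : IsTreeSet T) {D E : Set X} (hD : D ∈ T) (hE : E ∈ T)
    (h : D ⊂ E) : ∃ F, D ⊆ F ∧ Covered T F E := by
  obtain ⟨x, hx⟩ := hT.nonempty _ hD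
  obtain ⟨y, hy⟩ := hT.compl_nonempty hE
  have hfin : {F | F ∈ T ∧ D ⊆ F ∧ F ⊂ E}.Finite :=
    (hT.finite x y).subset fun F hF => ⟨hF.1, hF.2.1 hx, fun h => hy (hF.2.2.subset h)⟩
  obtain ⟨F, hF⟩ := hfin.exists_maximal ⟨D, hD, le_rfl, h⟩
  refine ⟨F, hF.prop.2.1, hF.prop.1, hE, hF.prop.2.2, fun K hK h1 h2 => ?_⟩
  by_contra hcon
  rw [not_or] at hcon
  exact hcon.1 ((hF.2 ⟨hK, hF.prop.2.1.trans h1, h2.ssubset_of_ne hcon.2⟩ h1).antisymm h1)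

/-- The stabilizer of the common vertex of the half-spaces cobounded with `D`. -/
def vertexStabilizer (hT : IsTreeSet T) (hinv : ∀ (g : G), ∀ D ∈ T, g • D ∈ T) (D : Set X) :
    Subgroup G where
  carrier := {g | Cobounded T (g • D) D}
  one_mem' := Or.inl (one_smul _ _)
  mul_mem' {a b} ha hb := by
    have := Cobounded.trans hT (hb.smul hinv a) ha
    rwa [← mul_smul] at this
  inv_mem' {a} ha := by
    have := Cobounded.smul hinv ha a⁻¹
    rw [inv_smul_smul] at this
    exact this.symm hT

/-- A subgroup containing all the elements which move an edge to an adjacent edge is everything. -/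
theorem eq_top_of_cobounded (hT : IsTreeSet T) (hinv : ∀ (g : G), ∀ D ∈ T, g • D ∈ T) {C : Set X}
    (hC : C ∈ T) (horb : ∀ D ∈ T, ∃ g : G, D = g • C ∨ D = (g • C)ᶜ) (K : Subgroup G)
    (h1 : ∀ g : G, Cobounded T (g • C) C → g ∈ K) (h2 : ∀ g : G, Cobounded T (g • Cᶜ) Cᶜ → g ∈ K)
    (h3 : ∀ g : G, Cobounded T (g • C) Cᶜ → g ∈ K) : K = ⊤ := by
  let good : Set X → Prop := fun D => ∃ k ∈ K, D = k • C ∨ D = (k • C)ᶜ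
  have good_compl : ∀ {D}, good D → good Dᶜ := by
    rintro D ⟨k, hk, rfl | rfl⟩
    · exact ⟨k, hk, Or.inr rfl⟩
    · exact ⟨k, hk, Or.inl (compl_compl _)⟩
  have good_cob : ∀ {D E}, D ∈ T → good E → Cobounded T D E → good D := by
    rintro D E hD ⟨k, hk, hE⟩ h
    obtain ⟨g, hg⟩ := horb D hD
    suffices k⁻¹ * g ∈ K from ⟨g, by simpa using K.mul_mem hk this, hg⟩
    have h' := Cobounded.smul hinv h k⁻¹
    rcases hE with rfl | rfl <;> rcases hg with rfl | rfl
    · rw [inv_smul_smul, ← mul_smul] at h'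
      exact h1 _ h'
    · rw [inv_smul_smul, Set.smul_set_compl, ← mul_smul] at h'
      have h'' := (Cobounded.smul hinv h' (k⁻¹ * g)⁻¹).symm hT
      rw [Set.smul_set_compl, inv_smul_smul] at h''
      exact (inv_mem_iff (H := K)).1 (h3 _ h'')
    · rw [Set.smul_set_compl, inv_smul_smul, ← mul_smul] at h'
      exact h3 _ h'
    · rw [Set.smul_set_compl, Set.smul_set_compl, inv_smul_smul, ← mul_smul,
        ← Set.smul_set_compl] at h'
      exact h2 _ h'
  have good_sub : ∀ {D E}, D ∈ T → E ∈ T → D ⊆ E → good E → good D := by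
    intro D E hD hE hDE hgE
    obtain ⟨x, hx⟩ := hT.nonempty _ hD
    obtain ⟨y, hy⟩ := hT.compl_nonempty hE
    have hfin : {F | F ∈ T ∧ D ⊆ F ∧ F ⊆ E ∧ good F}.Finite :=
      (hT.finite x y).subset fun F hF => ⟨hF.1, hF.2.1 hx, fun h => hy (hF.2.2.1 h)⟩
    obtain ⟨F, hF⟩ := hfin.exists_minimal ⟨E, hE, hDE, le_rfl, hgE⟩
    obtain ⟨hFT, hDF, hFE, hgF⟩ := hF.prop
    rcases hDF.eq_or_ssubset with rfl | hDF
    · exact hgF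
    obtain ⟨F', hDF', hF'⟩ := hT.exists_covered hD hFT hDF
    have hgF' : good F' :=
      good_cob hF'.left_mem (good_compl hgF) (Or.inr (by rwa [compl_compl]))
    exact (hF'.ssubset.not_subset (hF.2 ⟨hF'.left_mem, hDF', hF'.ssubset.subset.trans hFE, hgF'⟩
      hF'.ssubset.subset)).elim
  refine (Subgroup.eq_top_iff' K).2 fun g => ?_
  have hgC : g • C ∈ T := hinv g C hC
  have hgood : good C := ⟨1, K.one_mem, Or.inl (one_smul _ _).symm⟩
  have hCc := hT.compl_mem _ hC
  have hgCc := hT.compl_mem _ hgC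
  have hgg : good (g • C) := by
    rcases hT.nested C hC _ hgC with h | h | h | h
    · exact compl_compl (g • C) ▸
        good_compl (good_sub hgCc hCc (Set.compl_subset_compl.2 h) (good_compl hgood))
    · exact good_sub hgC hC h hgood
    · exact good_sub hgC hCc (Set.subset_compl_comm.1 h) (good_compl hgood)
    · exact compl_compl (g • C) ▸
        good_compl (good_sub hgCc hC (Set.compl_subset_comm.1 h) hgood)
  obtain ⟨k, hk, h | h⟩ := hgg
  · have : k⁻¹ * g ∈ K := h1 _ (Or.inl (by rw [mul_smul, h, inv_smul_smul]))
    simpa using K.mul_mem hk this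
  · have : k⁻¹ * g ∈ K :=
      h3 _ (Or.inl (by rw [mul_smul, h, Set.smul_set_compl, inv_smul_smul]))
    simpa using K.mul_mem hk this

end TreeSet

section Splitting

variable {G X : Type*} [Group G] [MulAction G X] {C : Set X}

theorem splitsOver_of_amalgam {A H J : Subgroup G} (hAH : A < H) (hAJ : A < J) (hC : C.Nonempty)
    (hCc : Cᶜ.Nonempty) (hA : ∀ a ∈ A, a • C = C) (hH : ∀ h ∈ H, h ∉ A → h • C ⊂ Cᶜ)
    (hJ : ∀ j ∈ J, j ∉ A → j • Cᶜ ⊆ C) (htop : H ⊔ J = ⊤) : SplitsOver G A := by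
  refine Or.inl ⟨H, J, hAH.le, hAJ.le, hAH.ne, hAJ.ne, ?_, ?_⟩
  · refine injective_of_pushoutI_pingPong (fun b => Subgroup.inclusion_injective _) hC hCc _
      (fun a h => ?_) (fun a => ?_) (fun h hh => ?_) (fun h hh => ?_)
    · rw [Monoid.PushoutI.lift_base] at h
      exact Subtype.ext h
    · rw [Monoid.PushoutI.lift_base]
      exact hA a a.2
    · rw [Monoid.PushoutI.lift_of]
      exact hH h h.2 fun ha => hh ⟨⟨h, ha⟩, rfl⟩
    · rw [Monoid.PushoutI.lift_of]
      exact hJ h h.2 fun ha => hh ⟨⟨h, ha⟩, rfl⟩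
  · rw [← MonoidHom.range_eq_top, eq_top_iff, ← htop, sup_le_iff]
    exact ⟨fun h hh => ⟨Monoid.PushoutI.of true ⟨h, hh⟩, by rw [Monoid.PushoutI.lift_of]; rfl⟩,
      fun h hh => ⟨Monoid.PushoutI.of false ⟨h, hh⟩, by rw [Monoid.PushoutI.lift_of]; rfl⟩⟩

theorem splitsOver_of_hnnExtension {A H : Subgroup G} (t : G) (hAH : A ≤ H)
    (htA : A.map (MulAut.conj t).toMonoidHom ≤ H) (P : ℤˣ → Set X)
    (ht : ∀ u : ℤˣ, t ^ (u : ℤ) • (P (-u))ᶜ ⊆ P u) (hsame : ∀ u, ∀ h ∈ H, h • P u ⊆ (P (-u))ᶜ)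
    (hpos : ∀ h ∈ H, h ∉ A.map (MulAut.conj t).toMonoidHom → h • P 1 ⊆ (P 1)ᶜ)
    (hneg : ∀ h ∈ H, h ∉ A → h • P (-1) ⊆ (P (-1))ᶜ)
    (hne : ∀ u v, ∀ h ∈ H, ¬ h • (P u)ᶜ ⊆ P v)
    (htop : ∀ K : Subgroup G, H ≤ K → t ∈ K → K = ⊤) : SplitsOver G A := by
  let φ : A.subgroupOf H ≃* (A.map (MulAut.conj t).toMonoidHom).subgroupOf H :=
    (Subgroup.subgroupOfEquivOfLe hAH).trans ((A.equivMapOfInjective (MulAut.conj t).toMonoidHom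
      (MulAut.conj t).injective).trans (Subgroup.subgroupOfEquivOfLe htA).symm)
  have hφ : ∀ a, ((φ a : H) : G) = t * ((a : H) : G) * t⁻¹ := fun a => rfl
  refine Or.inr ⟨H, hAH, t, htA, φ, hφ, fun a => ?_, ?_, ?_⟩
  · change t * ((a : H) : G) = ((φ a : H) : G) * t
    rw [hφ, inv_mul_cancel_right]
  · refine injective_of_hnnExtension_pingPong P _ (fun h hh => ?_) (fun u => ?_) (fun u h => ?_)
      (fun u h hh => ?_) (fun u v h => ?_)
    · rw [HNNExtension.lift_of] at hh
      exact Subtype.ext hh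
    · rw [HNNExtension.lift_t]
      exact ht u
    · rw [HNNExtension.lift_of]
      exact hsame u h h.2
    · rw [HNNExtension.lift_of]
      rcases Int.units_eq_one_or u with rfl | rfl
      · exact hpos h h.2 hh
      · exact hneg h h.2 (by simpa [Subgroup.mem_subgroupOf] using hh)
    · rw [HNNExtension.lift_of]
      exact hne u v h h.2
  · rw [← MonoidHom.range_eq_top]
    exact htop _ (fun h hh => ⟨HNNExtension.of ⟨h, hh⟩, by rw [HNNExtension.lift_of]; rfl⟩)
      ⟨HNNExtension.t, HNNExtension.lift_t _ _ _⟩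

variable {T : Set (Set X)}

/-- A group acting on a tree with a single orbit of unoriented edges, which is not trivial in the
sense that both half-spaces bounded by an edge contain other ones, splits over the stabilizer of an
edge. -/
theorem IsTreeSet.splitsOver (hT : IsTreeSet T) (hinv : ∀ (g : G), ∀ D ∈ T, g • D ∈ T)
    (hC : C ∈ T) (horb : ∀ D ∈ T, ∃ g : G, D = g • C ∨ D = (g • C)ᶜ) (hlt : ∃ D ∈ T, D ⊂ C)
    (hltc : ∃ D ∈ T, D ⊂ Cᶜ) : SplitsOver G (MulAction.stabilizer G C) := by
  have hCc := hT.compl_mem _ hC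
  have hA : ∀ a ∈ MulAction.stabilizer G C, a • C = C := fun a ha => ha
  obtain ⟨D, hDT, hD⟩ := hlt
  obtain ⟨D', hDT', hD'⟩ := hltc
  obtain ⟨F, -, hF⟩ := hT.exists_covered hDT hC hD
  obtain ⟨F', -, hF'⟩ := hT.exists_covered hDT' hCc hD'
  have hcob : ∀ {E : Set X}, Cobounded T E C → E ≠ C → E ⊂ Cᶜ := fun h hne =>
    (h.resolve_left hne).ssubset
  have hcobc : ∀ {E : Set X}, Cobounded T E Cᶜ → E ≠ Cᶜ → E ⊂ C := fun h hne => by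
    simpa using (h.resolve_left hne).ssubset
  by_cases hflip : ∃ i : G, i • C = Cᶜ
  · obtain ⟨i, hi⟩ := hflip
    have hi' : i⁻¹ • Cᶜ = C := by rw [← hi, inv_smul_smul]
    have hi'' : i • Cᶜ = C := by rw [Set.smul_set_compl, hi, compl_compl]
    let J : Subgroup G :=
      { carrier := {g | g • C = C ∨ g • C = Cᶜ}
        one_mem' := Or.inl (one_smul _ _)
        mul_mem' := by
          rintro a b (ha | ha) (hb | hb)
          · exact Or.inl (by rw [mul_smul, hb, ha])
          · exact Or.inr (by rw [mul_smul, hb, Set.smul_set_compl, ha])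
          · exact Or.inr (by rw [mul_smul, hb, ha])
          · exact Or.inl (by rw [mul_smul, hb, Set.smul_set_compl, ha, compl_compl])
        inv_mem' := by
          rintro a (ha | ha)
          · exact Or.inl (by rw [inv_smul_eq_iff, ha])
          · exact Or.inr (by rw [inv_smul_eq_iff, Set.smul_set_compl, ha, compl_compl]) }
    refine splitsOver_of_amalgam (H := vertexStabilizer hT hinv C) (J := J) (C := C)
      (SetLike.lt_iff_le_and_exists.2 ⟨fun a ha => Or.inl ha, ?_⟩)
      (SetLike.lt_iff_le_and_exists.2 ⟨fun a ha => Or.inl ha, i, Or.inr hi, fun h => ?_⟩)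
      (hT.nonempty _ hC) (hT.nonempty _ hCc) hA (fun h hh hhA => hcob hh hhA) ?_ ?_
    · have hFcob : Cobounded T F' C := Or.inr hF'
      have hFne : F' ≠ C := by
        rintro rfl
        obtain ⟨x, hx⟩ := hT.nonempty _ hC
        exact hF'.ssubset.subset hx hx
      obtain ⟨x, rfl | hx⟩ := horb F' hF'.left_mem
      · exact ⟨x, hFcob, hFne⟩
      · have : F' = (x * i) • C := by rw [hx, mul_smul, hi, Set.smul_set_compl]
        rw [this] at hFcob hFne
        exact ⟨x * i, hFcob, hFne⟩
    · obtain ⟨x, hx⟩ := hT.nonempty _ hC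
      have hCC : C = Cᶜ := (hA _ h).symm.trans hi
      exact hCC.subset hx hx
    · rintro j (hj | hj) hjA
      · exact (hjA hj).elim
      · rw [Set.smul_set_compl, hj, compl_compl]
    · have hHle : vertexStabilizer hT hinv C ≤ vertexStabilizer hT hinv C ⊔ J := le_sup_left
      have hiK : i ∈ vertexStabilizer hT hinv C ⊔ J :=
        (le_sup_right : J ≤ _) (Or.inr hi)
      have hmem : ∀ g, Cobounded T (g • C) Cᶜ → g ∈ vertexStabilizer hT hinv C ⊔ J := fun g hg => by
        have : i⁻¹ * g ∈ vertexStabilizer hT hinv C := by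
          change Cobounded T _ _
          rw [mul_smul]
          simpa only [hi'] using Cobounded.smul hinv hg i⁻¹
        simpa using mul_mem hiK (hHle this)
      refine eq_top_of_cobounded hT hinv hC horb _ (fun g hg => hHle hg) (fun g hg => ?_) hmem
      have := hmem (g * i) (by rwa [mul_smul, hi])
      simpa using mul_mem this (inv_mem hiK)
  by_cases htrans : ∃ t : G, Covered T (t • C) C
  · obtain ⟨t, ht⟩ := htrans
    have htcob : Cobounded T (t • C) Cᶜ := Or.inr (by rwa [compl_compl])
    let P : ℤˣ → Set X := fun u => if u = 1 then t • C else Cᶜ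
    have hP1 : P 1 = t • C := rfl
    have hPn : P (-1) = Cᶜ := rfl
    have hPT : ∀ u, P u ∈ T := fun u => by
      rcases Int.units_eq_one_or u with rfl | rfl
      exacts [ht.left_mem, hCc]
    have hPcob : ∀ u, Cobounded T (P u) Cᶜ := fun u => by
      rcases Int.units_eq_one_or u with rfl | rfl
      exacts [htcob, Or.inl rfl]
    have hcov : ∀ u v, ∀ h ∈ vertexStabilizer hT hinv Cᶜ, Cobounded T (h • P u) (P v) :=
      fun u v h hh => (((hPcob u).smul hinv h).trans hT hh).trans hT ((hPcob v).symm hT)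
    have hsub : ∀ {D E : Set X}, Cobounded T D E → D ≠ E → D ⊆ Eᶜ := fun h hne =>
      (h.resolve_left hne).ssubset.subset
    have hAt : ∀ h : G, h • t • C = t • C →
        h ∈ (MulAction.stabilizer G C).map (MulAut.conj t).toMonoidHom := fun h hh => by
      refine ⟨t⁻¹ * h * t, ?_, by simp [mul_assoc]⟩
      change (t⁻¹ * h * t) • C = C
      rw [mul_smul, mul_smul, hh, inv_smul_smul]
    refine splitsOver_of_hnnExtension (H := vertexStabilizer hT hinv Cᶜ) t
      (fun a ha => Or.inl (by rw [Set.smul_set_compl, hA a ha])) ?_ P (fun u => ?_)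
      (fun u h hh => hsub (hcov _ _ h hh) ?_) (fun h hh hhA => hsub (hcov _ _ h hh) ?_)
      (fun h hh hhA => hsub (hcov _ _ h hh) ?_) (fun u v h hh hsubset => ?_) (fun K hK htK => ?_)
    · rintro _ ⟨a, ha, rfl⟩
      have h1 : (t * a * t⁻¹) • t • C = t • C := by
        rw [mul_smul, mul_smul, inv_smul_smul, hA a ha]
      change Cobounded T ((t * a * t⁻¹) • Cᶜ) Cᶜ
      have h2 := (htcob.symm hT).smul hinv (t * a * t⁻¹)
      rw [h1] at h2
      exact h2.trans hT htcob
    · rcases Int.units_eq_one_or u with rfl | rfl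
      · rw [hPn, compl_compl, hP1, Units.val_one, zpow_one]
      · rw [neg_neg, hPn, hP1, ← Set.smul_set_compl, Units.val_neg, Units.val_one, zpow_neg_one,
          inv_smul_smul]
    · rcases Int.units_eq_one_or u with rfl | rfl
      · rw [hPn, hP1, ← mul_smul]
        exact fun h => hflip ⟨_, h⟩
      · rw [neg_neg, hPn, hP1]
        exact fun h' => hflip ⟨t⁻¹ * h, by
          rw [mul_smul, inv_smul_eq_iff, Set.smul_set_compl, ← h', Set.smul_set_compl, compl_compl]⟩
    · exact fun h' => hhA (hAt h h')
    · rw [hPn, Set.smul_set_compl]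
      exact fun h' => hhA (compl_injective h')
    · rcases hcov u v h hh with h' | h'
      · rw [Set.smul_set_compl, h'] at hsubset
        obtain ⟨x, hx⟩ := hT.compl_nonempty (hPT v)
        exact hx (hsubset hx)
      · rw [Set.smul_set_compl] at hsubset
        exact h'.ssubset.not_subset (Set.compl_subset_comm.1 hsubset)
    · refine eq_top_of_cobounded hT hinv hC horb K (fun g hg => ?_) (fun g hg => hK hg)
        (fun g hg => ?_)
      · have : t * g * t⁻¹ ∈ K := by
          refine hK (?_ : Cobounded T _ _)
          have h1 := (htcob.symm hT).smul hinv (t * g * t⁻¹)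
          rw [mul_smul _ _ (t • C), mul_smul t, inv_smul_smul] at h1
          exact (h1.trans hT (hg.smul hinv t)).trans hT htcob
        simpa [mul_assoc] using K.mul_mem (K.mul_mem (K.inv_mem htK) this) htK
      · have : g * t⁻¹ ∈ K := by
          refine hK (?_ : Cobounded T _ _)
          have h1 := (htcob.symm hT).smul hinv (g * t⁻¹)
          rw [mul_smul _ _ (t • C), inv_smul_smul] at h1
          exact h1.trans hT hg
        simpa using K.mul_mem this htK
  · have hno : ∀ g : G, ¬ Cobounded T (g • C) Cᶜ := fun g hg => by
      rcases hg with hg | hg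
      · exact hflip ⟨g, hg⟩
      · exact htrans ⟨g, by rwa [compl_compl] at hg⟩
    refine splitsOver_of_amalgam (H := vertexStabilizer hT hinv C)
      (J := vertexStabilizer hT hinv Cᶜ) (C := C)
      (SetLike.lt_iff_le_and_exists.2 ⟨fun a ha => Or.inl ha, ?_⟩)
      (SetLike.lt_iff_le_and_exists.2 ⟨fun a ha =>
        Or.inl (by rw [Set.smul_set_compl, hA a ha]), ?_⟩)
      (hT.nonempty _ hC) (hT.nonempty _ hCc) hA (fun h hh hhA => hcob hh hhA)
      (fun j hj hjA => (hcobc hj fun h => hjA ?_).subset) ?_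
    · obtain ⟨x, rfl | hx⟩ := horb F' hF'.left_mem
      · refine ⟨x, Or.inr hF', fun h => ?_⟩
        rw [hA x h] at hF'
        obtain ⟨y, hy⟩ := hT.nonempty _ hC
        exact hF'.ssubset.subset hy hy
      · refine (hno x⁻¹ ?_).elim
        rw [hx] at hF'
        have h1 : Cobounded T (x • Cᶜ) C := Or.inr (by rwa [Set.smul_set_compl])
        simpa using (h1.smul hinv x⁻¹).symm hT
    · obtain ⟨x, rfl | hx⟩ := horb F hF.left_mem
      · exact (hno x (Or.inr (by rwa [compl_compl]))).elim
      · rw [hx, ← Set.smul_set_compl] at hF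
        refine ⟨x, Or.inr (by rwa [compl_compl]), fun h => ?_⟩
        rw [Set.smul_set_compl, hA x h] at hF
        obtain ⟨y, hy⟩ := hT.nonempty _ hCc
        exact hy (hF.ssubset.subset hy)
    · rw [Set.smul_set_compl] at h
      exact compl_injective h
    · exact eq_top_of_cobounded hT hinv hC horb _ (fun g hg => Subgroup.mem_sup_left hg)
        (fun g hg => Subgroup.mem_sup_right hg) (fun g hg => (hno g hg).elim)

end Splitting

section Cayley

variable {G : Type*} [Group G] {S : Set G}

/-- The target map of the Cayley graph of `G` with respect to `S`, whose edges `(g, s)` join `g` to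
`g * s`. -/
def cayleyTarget (S : Set G) (e : G × S) : G := e.1 * e.2

theorem isConnected_cayley (hS : Subgroup.closure S = ⊤) :
    IsConnected Prod.fst (cayleyTarget S) := by
  intro D hD
  have hmul : ∀ g : G, ∀ x, x ∈ D ↔ x * g ∈ D := by
    intro g
    have hg : g ∈ Subgroup.closure S := hS ▸ Subgroup.mem_top g
    induction hg using Subgroup.closure_induction with
    | mem s hs =>
      intro x
      by_contra h
      exact Set.eq_empty_iff_forall_notMem.1 hD (x, ⟨s, hs⟩) h
    | one => simp
    | mul a b _ _ ha hb => exact fun x => by rw [ha, hb, mul_assoc]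
    | inv a _ ha => exact fun x => by rw [ha (x * a⁻¹), inv_mul_cancel_right]
  rcases D.eq_empty_or_nonempty with h | ⟨x, hx⟩
  · exact Or.inl h
  · exact Or.inr (Set.eq_univ_of_forall fun y => by simpa using (hmul (x⁻¹ * y) x).1 hx)

theorem isCut_cayley (hS : S.Finite) {C : Set G} (hC : C.Infinite) (hCc : Cᶜ.Infinite)
    (hfin : ∀ g : G, (((fun c => c * g) '' C) \ C).Finite) :
    IsCut Prod.fst (cayleyTarget S) C := by
  refine ⟨?_, hC, hCc⟩
  have := hS.to_subtype
  refine (Set.finite_iUnion fun s : S => (((hfin s).image fun x => (x * (s : G)⁻¹, s)).union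
    ((hfin (s : G)⁻¹).image fun x => (x, s)))).subset ?_
  rintro ⟨x, s⟩ hx
  simp only [coboundary, cayleyTarget, Set.mem_ofPred_eq] at hx
  refine Set.mem_iUnion.2 ⟨s, ?_⟩
  by_cases hxC : x ∈ C
  · exact Or.inl ⟨x * s, ⟨⟨x, hxC, rfl⟩, by tauto⟩, by simp⟩
  · exact Or.inr ⟨x, ⟨⟨x * s, by tauto, by simp⟩, hxC⟩, rfl⟩

theorem coboundary_smul (g : G) (D : Set G) :
    coboundary Prod.fst (cayleyTarget S) (g • D) =
      (fun e : G × S => (g * e.1, e.2)) '' coboundary Prod.fst (cayleyTarget S) D := by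
  ext ⟨x, s⟩
  simp only [coboundary, cayleyTarget, Set.mem_image, Set.mem_ofPred_eq, Prod.exists,
    Prod.mk.injEq, Set.mem_smul_set_iff_inv_smul_mem, smul_eq_mul]
  constructor
  · exact fun h => ⟨g⁻¹ * x, s, by simpa [mul_assoc] using h, by simp, rfl⟩
  · rintro ⟨y, s, h, rfl, rfl⟩
    simpa [mul_assoc] using h

theorem injective_mul_left_prodMk (g : G) :
    Function.Injective fun e : G × S => (g * e.1, e.2) := by
  rintro ⟨x, s⟩ ⟨y, t⟩ h
  simpa using h

theorem IsMinCut.smul {D : Set G} (hD : IsMinCut Prod.fst (cayleyTarget S) D) (g : G) :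
    IsMinCut Prod.fst (cayleyTarget S) (g • D) := by
  refine ⟨⟨?_, hD.infinite.smul_set, ?_⟩, ?_⟩
  · rw [coboundary_smul]
    exact hD.finite.image _
  · rw [← Set.smul_set_compl]
    exact hD.infinite_compl.smul_set
  · rw [coboundary_smul, Set.ncard_image_of_injective _ (injective_mul_left_prodMk g)]
    exact hD.le

theorem Nested.smul {D E : Set G} (h : Nested D E) (g : G) : Nested (g • D) (g • E) := by
  simpa only [Nested, ← Set.smul_set_compl, Set.smul_set_subset_smul_set_iff] using h

theorem crossing_smul (g : G) (D : Set G) :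
    crossing Prod.fst (cayleyTarget S) (g • D) = g • crossing Prod.fst (cayleyTarget S) D := by
  ext E
  rw [Set.mem_smul_set_iff_inv_smul_mem]
  refine and_congr ⟨fun h => h.smul _, fun h => by simpa using h.smul g⟩
    (not_congr ⟨fun h => by simpa using h.smul g⁻¹, fun h => by simpa using h.smul g⟩)

theorem ncard_crossing_smul (g : G) (D : Set G) :
    (crossing Prod.fst (cayleyTarget S) (g • D)).ncard =
      (crossing Prod.fst (cayleyTarget S) D).ncard := by
  rw [crossing_smul]
  exact Set.ncard_image_of_injective _ (MulAction.injective g)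

/-- A minimal cut crossing as few minimal cuts as possible is nested with its translates. -/
theorem exists_isMinCut_nested (hS : Subgroup.closure S = ⊤) {C : Set G}
    (hC : IsCut Prod.fst (cayleyTarget S) C) :
    ∃ D, IsMinCut Prod.fst (cayleyTarget S) D ∧ ∀ g : G, Nested D (g • D) := by
  obtain ⟨D, hD, hmin⟩ := (measure fun D : Set G =>
    (crossing Prod.fst (cayleyTarget S) D).ncard).wf.has_min
    {D | IsMinCut Prod.fst (cayleyTarget S) D} (exists_isMinCut hC)
  exact ⟨D, hD, fun g => nested_of_ncard_crossing_minimal (isConnected_cayley hS) hD (hD.smul g)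
    (fun F hF => not_lt.1 (hmin F hF)) (ncard_crossing_smul g D)⟩

theorem IsMinCut.coboundary_nonempty (hS : Subgroup.closure S = ⊤) {D : Set G}
    (hD : IsMinCut Prod.fst (cayleyTarget S) D) :
    (coboundary Prod.fst (cayleyTarget S) D).Nonempty := by
  rw [Set.nonempty_iff_ne_empty]
  intro h
  rcases isConnected_cayley hS D h with rfl | rfl
  · exact hD.infinite Set.finite_empty
  · exact hD.infinite_compl (by simp)

theorem IsMinCut.finite_stabilizer (hS : Subgroup.closure S = ⊤) {D : Set G}
    (hD : IsMinCut Prod.fst (cayleyTarget S) D) : Finite (MulAction.stabilizer G D) := by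
  obtain ⟨e, he⟩ := hD.coboundary_nonempty hS
  have := hD.finite.to_subtype
  refine Finite.of_injective (β := coboundary Prod.fst (cayleyTarget S) D)
    (fun a => ⟨(a * e.1, e.2), ?_⟩) fun a b h => ?_
  · have ha : (a : G) • D = D := a.2
    have h : (a * e.1, e.2) ∈ coboundary Prod.fst (cayleyTarget S) ((a : G) • D) := by
      rw [coboundary_smul]
      exact ⟨e, he, rfl⟩
    rwa [ha] at h
  · simpa using h

/-- A minimal cut nested with its translates properly contains one of them, up to complement. -/
theorem IsMinCut.exists_smul_ssubset (hS : Subgroup.closure S = ⊤) {D : Set G}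
    (hD : IsMinCut Prod.fst (cayleyTarget S) D) (hn : ∀ g : G, Nested D (g • D)) :
    ∃ g : G, g • D ⊂ D ∨ (g • D)ᶜ ⊂ D := by
  obtain ⟨e, he⟩ := hD.coboundary_nonempty hS
  obtain ⟨x, hxD, hx⟩ := (hD.infinite.sdiff (hD.finite.image Prod.fst)).nonempty
  set g := x * e.1⁻¹ with hg
  have hxe : (x, e.2) ∉ coboundary Prod.fst (cayleyTarget S) D := fun h => hx ⟨_, h, rfl⟩
  have hge : (x, e.2) ∈ coboundary Prod.fst (cayleyTarget S) (g • D) := by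
    rw [coboundary_smul]
    exact ⟨e, he, by simp [hg]⟩
  simp only [coboundary, Set.mem_ofPred_eq] at hxe hge
  generalize cayleyTarget S (x, e.2) = y at hxe hge
  refine ⟨g, ?_⟩
  rcases hn g with h | h | h | h
  · have := @h x; have := @h y; tauto
  · refine Or.inl (h.ssubset_of_ne fun h' => ?_)
    rw [h'] at hge; tauto
  · have := @h x; have := @h y; simp only [Set.mem_compl_iff] at *; tauto
  · refine Or.inr ((Set.compl_subset_comm.1 h).ssubset_of_ne fun h' => ?_)
    rw [← h'] at hxe
    simp only [Set.mem_compl_iff] at hxe; tauto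

/-- The translates of a minimal cut nested with its translates, together with their complements,
form a tree set. -/
theorem IsMinCut.isTreeSet (hS : Subgroup.closure S = ⊤) {D : Set G}
    (hD : IsMinCut Prod.fst (cayleyTarget S) D) (hn : ∀ g : G, Nested D (g • D)) :
    IsTreeSet {E | ∃ g : G, E = g • D ∨ E = (g • D)ᶜ} := by
  have hcut : ∀ E ∈ {E | ∃ g : G, E = g • D ∨ E = (g • D)ᶜ},
      IsMinCut Prod.fst (cayleyTarget S) E := by
    rintro E ⟨g, rfl | rfl⟩
    · exact hD.smul g
    · exact (hD.smul g).compl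
  have hnn : ∀ g h : G, Nested (g • D) (h • D) := fun g h => by
    simpa [smul_smul] using (hn (g⁻¹ * h)).smul g
  refine ⟨?_, fun E hE => (hcut E hE).nonempty, ?_, fun x y =>
    (finite_setOf_isMinCut_separating (isConnected_cayley hS) x y).subset
      fun E hE => ⟨hcut E hE.1, hE.2⟩⟩
  · rintro E ⟨g, rfl | rfl⟩
    · exact ⟨g, Or.inr rfl⟩
    · exact ⟨g, Or.inl (compl_compl _)⟩
  · rintro E ⟨g, rfl | rfl⟩ F ⟨h, rfl | rfl⟩
    · exact hnn g h
    · exact (hnn g h).compl_right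
    · exact (hnn g h).compl_left
    · exact (hnn g h).compl_left.compl_right

theorem IsMinCut.splitsOver_stabilizer (hS : Subgroup.closure S = ⊤) {D : Set G}
    (hD : IsMinCut Prod.fst (cayleyTarget S) D) (hn : ∀ g : G, Nested D (g • D)) :
    SplitsOver G (MulAction.stabilizer G D) := by
  have hnc : ∀ g : G, Nested Dᶜ (g • Dᶜ) := fun g => by
    rw [Set.smul_set_compl]
    exact (hn g).compl_left.compl_right
  obtain ⟨g, hg⟩ := hD.exists_smul_ssubset hS hn
  obtain ⟨h, hh⟩ := hD.compl.exists_smul_ssubset hS hnc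
  simp only [Set.smul_set_compl, compl_compl] at hh
  refine (hD.isTreeSet hS hn).splitsOver ?_ ⟨1, Or.inl (one_smul _ _).symm⟩ (fun _ h => h) ?_ ?_
  · rintro a E ⟨b, rfl | rfl⟩
    · exact ⟨a * b, Or.inl (mul_smul _ _ _).symm⟩
    · exact ⟨a * b, Or.inr (by rw [mul_smul, Set.smul_set_compl])⟩
  · exact hg.elim (fun hg => ⟨_, ⟨g, Or.inl rfl⟩, hg⟩) fun hg => ⟨_, ⟨g, Or.inr rfl⟩, hg⟩
  · exact hh.elim (fun hh => ⟨_, ⟨h, Or.inr rfl⟩, hh⟩) fun hh => ⟨_, ⟨h, Or.inl rfl⟩, hh⟩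

end Cayley

end EndCuts

/-- Stallings' theorem: a finitely generated group with more than one end (witnessed
by a set `C ⊆ G` with `C` and `G \ C` infinite and `Cg \ C` finite for all `g`)
splits over some finite subgroup. -/
theorem splits_of_more_than_one_end {G : Type*} [Group G] [Group.FG G]
    (C : Set G) (hC : C.Infinite) (hCc : Cᶜ.Infinite)
    (hfin : ∀ g : G, (((fun c => c * g) '' C) \ C).Finite) :
    ∃ A : Subgroup G, Finite A ∧ SplitsOver G A := by
  obtain ⟨S, hS⟩ := Group.FG.out (G := G)
  obtain ⟨D, hD, hn⟩ :=
    EndCuts.exists_isMinCut_nested hS (EndCuts.isCut_cayley S.finite_toSet hC hCc hfin)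
  exact ⟨_, hD.finite_stabilizer hS, hD.splitsOver_stabilizer hS hn⟩
end
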